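/- arXiv:2112.04372 — 7 statements merged into one kernel-verified Lean document; each statement's English description precedes it below -/
import Mathlib

section
/- Let T>0, R>0, n≥1 and Ξ={ξ∈ℝⁿ : |ξ|≥R}. Let A1,A2,A3:[0,T]×Ξ→ℝ be continuous and suppose that for every (t,ξ) the monic cubic L(t,τ,ξ)=τ³+A1(t,ξ)τ²+A2(t,ξ)τ+A3(t,ξ) has three real roots τ1(t,ξ)≤τ2(t,ξ)≤τ3(t,ξ). Let λ1(t,ξ)<λ2(t,ξ)<λ3(t,ξ) be real functions that for every (t,ξ) are the three (real and distinct) roots of the auxiliary cubic 𝓛(t,τ,ξ)=L(t,τ,ξ)−(6τ+2A1(t,ξ)). Let M̌(t,τ,ξ)=B0(t,ξ)+B1(t,ξ)τ+B2(t,ξ)τ² where B0,B1,B2:[0,T]×Ξ→ℂ are continuous and |B2(t,ξ)|≤K for all (t,ξ) and some constant K. Then the following two conditions are equivalent: (i) there exists C>0 such that for all ξ∈Ξ, ∫₀ᵀ Σ_{(j,k,l)∈S3} |M̌(t,λ_j(t,ξ),ξ)| / (|λ_j(t,ξ)−λ_k(t,ξ)|·|λ_j(t,ξ)−λ_l(t,ξ)|)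 dt ≤ C·log(1+|ξ|); (ii) there exists C>0 such that for all ξ∈Ξ both ∫₀ᵀ Σ_{(j,k,l)∈S3} |M̌(t,τ_j(t,ξ),ξ)| / ((|τ_j(t,ξ)−τ_k(t,ξ)|+1)(|τ_j(t,ξ)−τ_l(t,ξ)|+1)) dt ≤ C·log(1+|ξ|) and ∫₀ᵀ (|∂τM̌(t,τ1(t,ξ),ξ)|+|∂τM̌(t,τ3(t,ξ),ξ)|) / (|τ1(t,ξ)−τ3(t,ξ)|+1) dt ≤ C·log(1+|ξ|), where ∂τM̌(t,τ,ξ)=B1(t,ξ)+2B2(t,ξ)τ. -/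
open Set MeasureTheory

/-- Discriminant bound: the symmetric functions of the roots of a cubic minus its second derivative
force consecutive roots to be at distance at least one. -/
lemma one_le_sub_of_symm_eq {x1 x2 x3 y1 y2 y3 : ℝ} (hy12 : y1 < y2) (hy23 : y2 < y3)
    (e1 : y1 + y2 + y3 = x1 + x2 + x3)
    (e2 : y1 * y2 + y1 * y3 + y2 * y3 = x1 * x2 + x1 * x3 + x2 * x3 - 6)
    (e3 : y1 * y2 * y3 = x1 * x2 * x3 - 2 * (x1 + x2 + x3)) :
    1 ≤ y2 - y1 ∧ 1 ≤ y3 - y2 := by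
  have key : 3 / 2 * (y3 - y1) ^ 2 ≤ ((y2 - y1) * (y3 - y2)) ^ 2 := by
    set P := x1 ^ 2 + x2 ^ 2 + x3 ^ 2 - x1 * x2 - x1 * x3 - x2 * x3 with hP
    have hP0 : 0 ≤ P := by
      nlinarith [sq_nonneg (x1 - x2), sq_nonneg (x2 - x3), sq_nonneg (x1 - x3)]
    have hPy : y1 ^ 2 + y2 ^ 2 + y3 ^ 2 - y1 * y2 - y1 * y3 - y2 * y3 = P + 18 := by
      have : (y1 + y2 + y3) ^ 2 = (x1 + x2 + x3) ^ 2 := by rw [e1]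
      rw [hP]; linarith
    set Q := 2 * (x1 + x2 + x3) ^ 3
      - 9 * (x1 + x2 + x3) * (x1 * x2 + x1 * x3 + x2 * x3) + 27 * (x1 * x2 * x3) with hQ
    have hQy : 2 * (y1 + y2 + y3) ^ 3
      - 9 * (y1 + y2 + y3) * (y1 * y2 + y1 * y3 + y2 * y3) + 27 * (y1 * y2 * y3) = Q := by
      rw [e1, e2, e3, hQ]; ring
    have dx : 27 * ((x2 - x1) * (x3 - x2) * (x3 - x1)) ^ 2 = 4 * P ^ 3 - Q ^ 2 := by
      rw [hP, hQ]; ring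
    have dy : 27 * ((y2 - y1) * (y3 - y2) * (y3 - y1)) ^ 2 = 4 * (P + 18) ^ 3 - Q ^ 2 := by
      rw [← hPy, ← hQy]; ring
    have hQP : Q ^ 2 ≤ 4 * P ^ 3 := by
      linarith [sq_nonneg ((x2 - x1) * (x3 - x2) * (x3 - x1))]
    have h72 : 72 * (P + 18) ^ 2 ≤ 27 * ((y2 - y1) * (y3 - y2) * (y3 - y1)) ^ 2 := by
      rw [dy]; linarith [sq_nonneg P]
    have hPD : 3 / 4 * (y3 - y1) ^ 2 ≤ P + 18 := by
      rw [← hPy]; nlinarith [sq_nonneg (y1 + y3 - 2 * y2)]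
    have hPD2 : (3 / 4 * (y3 - y1) ^ 2) ^ 2 ≤ (P + 18) ^ 2 :=
      pow_le_pow_left₀ (by positivity) hPD 2
    have hD : 0 < (y3 - y1) ^ 2 := by
      have : 0 < y3 - y1 := by linarith
      positivity
    refine le_of_mul_le_mul_right ?_ hD
    linarith
  have key' : y3 - y1 ≤ (y2 - y1) * (y3 - y2) := by
    refine (abs_le_of_sq_le_sq' ?_ (mul_nonneg (by linarith) (by linarith))).2
    linarith [sq_nonneg (y3 - y1)]
  constructor
  · by_contra! hlt
    nlinarith [mul_lt_mul_of_pos_right hlt (sub_pos.2 hy23)]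
  · by_contra! hlt
    nlinarith [mul_lt_mul_of_pos_left hlt (sub_pos.2 hy12)]

/-- If the cubic with ordered real roots `xᵢ` minus its second derivative has ordered roots `yᵢ`,
then `|yᵢ - xᵢ| ≤ 3` and consecutive `yᵢ` are at distance at least one. -/
lemma cubic_sub_second_deriv_roots {x1 x2 x3 y1 y2 y3 : ℝ} (hx12 : x1 ≤ x2) (hx23 : x2 ≤ x3)
    (hy12 : y1 < y2) (hy23 : y2 < y3)
    (h : ∀ τ : ℝ, (τ - x1) * (τ - x2) * (τ - x3) - (6 * τ - 2 * (x1 + x2 + x3))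
      = (τ - y1) * (τ - y2) * (τ - y3)) :
    (|y1 - x1| ≤ 3 ∧ |y2 - x2| ≤ 3 ∧ |y3 - x3| ≤ 3) ∧ 1 ≤ y2 - y1 ∧ 1 ≤ y3 - y2 := by
  have h0 := h 0
  have h1 := h 1
  have h2 := h (-1)
  have e1 : y1 + y2 + y3 = x1 + x2 + x3 := by linarith
  have e2 : y1 * y2 + y1 * y3 + y2 * y3 = x1 * x2 + x1 * x3 + x2 * x3 - 6 := by linarith
  have e3 : y1 * y2 * y3 = x1 * x2 * x3 - 2 * (x1 + x2 + x3) := by linarith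
  have hx3y3 : x3 ≤ y3 := by
    by_contra! hlt
    have := h x3
    have : 0 < (x3 - y1) * (x3 - y2) * (x3 - y3) := by
      apply mul_pos (mul_pos _ _) <;> linarith
    nlinarith
  have hy1x1 : y1 ≤ x1 := by
    by_contra! hlt
    have := h x1
    have : 0 < (y1 - x1) * (y2 - x1) * (y3 - x1) := by
      apply mul_pos (mul_pos _ _) <;> linarith
    nlinarith
  have hy3 : y3 - x3 ≤ 3 := by
    by_contra! hlt
    have h3 := h y3
    have hb : 9 ≤ (y3 - x2) * (y3 - x3) := by nlinarith
    nlinarith [mul_le_mul_of_nonneg_left hb (by linarith : 0 ≤ y3 - x1)]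
  have hy1 : x1 - y1 ≤ 3 := by
    by_contra! hlt
    have h3 := h y1
    have hb : 9 ≤ (x2 - y1) * (x1 - y1) := by nlinarith
    nlinarith [mul_le_mul_of_nonneg_left hb (by linarith : 0 ≤ x3 - y1)]
  obtain ⟨hs, hr⟩ := one_le_sub_of_symm_eq hy12 hy23 e1 e2 e3
  refine ⟨⟨?_, ?_, ?_⟩, ?_, ?_⟩
  · rw [abs_le]; constructor <;> linarith
  · rw [abs_le]; constructor <;> linarith
  · rw [abs_le]; constructor <;> linarith
  · exact hs
  · exact hr

lemma norm_quadratic_le {b0 b1 b2 : ℂ} {K x y : ℝ} (hK : ‖b2‖ ≤ K) (hxy : |x - y| ≤ 3) :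
    ‖b0 + b1 * (x : ℂ) + b2 * (x : ℂ) ^ 2‖
      ≤ ‖b0 + b1 * (y : ℂ) + b2 * (y : ℂ) ^ 2‖ + 3 * ‖b1 + 2 * b2 * (y : ℂ)‖ + 9 * K := by
  have e : b0 + b1 * (x : ℂ) + b2 * (x : ℂ) ^ 2
      = (b0 + b1 * (y : ℂ) + b2 * (y : ℂ) ^ 2)
        + (b1 + 2 * b2 * (y : ℂ)) * ((x - y : ℝ) : ℂ) + b2 * ((x - y : ℝ) : ℂ) ^ 2 := by
    push_cast; ring
  rw [e]
  refine (norm_add₃_le).trans ?_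
  rw [norm_mul, norm_mul, norm_pow, Complex.norm_real, Real.norm_eq_abs]
  have h9 : |x - y| ^ 2 ≤ 9 := by nlinarith [abs_nonneg (x - y)]
  have i1 := mul_le_mul_of_nonneg_left hxy (norm_nonneg (b1 + 2 * b2 * (y : ℂ)))
  have i2 : ‖b2‖ * |x - y| ^ 2 ≤ K * 9 :=
    mul_le_mul hK h9 (by positivity) ((norm_nonneg _).trans hK)
  linarith

lemma norm_quadratic_deriv_le {b1 b2 : ℂ} {K x y : ℝ} (hK : ‖b2‖ ≤ K) (hxy : |x - y| ≤ 3) :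
    ‖b1 + 2 * b2 * (x : ℂ)‖ ≤ ‖b1 + 2 * b2 * (y : ℂ)‖ + 6 * K := by
  have e : b1 + 2 * b2 * (x : ℂ)
      = (b1 + 2 * b2 * (y : ℂ)) + 2 * b2 * ((x - y : ℝ) : ℂ) := by
    push_cast; ring
  rw [e]
  refine (norm_add_le _ _).trans ?_
  rw [norm_mul, norm_mul, Complex.norm_real, Real.norm_eq_abs, Complex.norm_ofNat]
  have i2 : ‖b2‖ * |x - y| ≤ K * 3 :=
    mul_le_mul hK hxy (by positivity) ((norm_nonneg _).trans hK)
  linarith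

/-- An affine function on an interval is bounded by the sum of its norms at the end points. -/
lemma norm_affine_le_add {b c : ℂ} {x1 x2 x3 : ℝ} (h12 : x1 ≤ x2) (h23 : x2 ≤ x3) :
    ‖b + c * (x2 : ℂ)‖ ≤ ‖b + c * (x1 : ℂ)‖ + ‖b + c * (x3 : ℂ)‖ := by
  rcases (h12.trans h23).eq_or_lt with h | h
  · have : x2 = x1 := le_antisymm (by linarith) h12
    rw [this]
    linarith [norm_nonneg (b + c * (x3 : ℂ))]
  · have hd : 0 < x3 - x1 := by linarith
    refine le_of_mul_le_mul_left ?_ hd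
    have e : ((x3 - x1 : ℝ) : ℂ) * (b + c * (x2 : ℂ))
        = ((x3 - x2 : ℝ) : ℂ) * (b + c * (x1 : ℂ))
          + ((x2 - x1 : ℝ) : ℂ) * (b + c * (x3 : ℂ)) := by
      push_cast; ring
    have e' := congrArg norm e
    rw [norm_mul, Complex.norm_real, Real.norm_of_nonneg hd.le] at e'
    rw [e']
    refine (norm_add_le _ _).trans ?_
    rw [norm_mul, norm_mul, Complex.norm_real, Complex.norm_real,
      Real.norm_of_nonneg (by linarith), Real.norm_of_nonneg (by linarith)]
    nlinarith [mul_nonneg (sub_nonneg.2 h12) (norm_nonneg (b + c * (x1 : ℂ))),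
      mul_nonneg (sub_nonneg.2 h23) (norm_nonneg (b + c * (x3 : ℂ)))]

/-- The derivative of a quadratic, estimated by Lagrange interpolation at three nodes. -/
lemma norm_quadratic_deriv_le_interpolation {b0 b1 b2 : ℂ} {y1 y2 y3 z : ℝ}
    (h12 : y1 < y2) (h23 : y2 < y3) (hz1 : y1 ≤ z) (hz3 : z ≤ y3) :
    ‖b1 + 2 * b2 * (z : ℂ)‖ ≤ 2 * (y3 - y1) *
      (‖b0 + b1 * (y1 : ℂ) + b2 * (y1 : ℂ) ^ 2‖ / (|y1 - y2| * |y1 - y3|)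
        + ‖b0 + b1 * (y2 : ℂ) + b2 * (y2 : ℂ) ^ 2‖ / (|y2 - y3| * |y2 - y1|)
        + ‖b0 + b1 * (y3 : ℂ) + b2 * (y3 : ℂ) ^ 2‖ / (|y3 - y1| * |y3 - y2|)) := by
  have n12 : (y1 : ℂ) - y2 ≠ 0 := sub_ne_zero.2 (by exact_mod_cast h12.ne)
  have n23 : (y2 : ℂ) - y3 ≠ 0 := sub_ne_zero.2 (by exact_mod_cast h23.ne)
  have n13 : (y1 : ℂ) - y3 ≠ 0 := sub_ne_zero.2 (by exact_mod_cast (h12.trans h23).ne)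
  have n21 : (y2 : ℂ) - y1 ≠ 0 := sub_ne_zero.2 (by exact_mod_cast h12.ne')
  have n32 : (y3 : ℂ) - y2 ≠ 0 := sub_ne_zero.2 (by exact_mod_cast h23.ne')
  have n31 : (y3 : ℂ) - y1 ≠ 0 := sub_ne_zero.2 (by exact_mod_cast (h12.trans h23).ne')
  have e : b1 + 2 * b2 * (z : ℂ)
      = (b0 + b1 * (y1 : ℂ) + b2 * (y1 : ℂ) ^ 2)
          / (((y1 - y2 : ℝ) : ℂ) * ((y1 - y3 : ℝ) : ℂ)) * ((2 * z - y2 - y3 : ℝ) : ℂ)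
        + (b0 + b1 * (y2 : ℂ) + b2 * (y2 : ℂ) ^ 2)
          / (((y2 - y3 : ℝ) : ℂ) * ((y2 - y1 : ℝ) : ℂ)) * ((2 * z - y1 - y3 : ℝ) : ℂ)
        + (b0 + b1 * (y3 : ℂ) + b2 * (y3 : ℂ) ^ 2)
          / (((y3 - y1 : ℝ) : ℂ) * ((y3 - y2 : ℝ) : ℂ)) * ((2 * z - y1 - y2 : ℝ) : ℂ) := by
    push_cast
    rw [← neg_sub (y1 : ℂ) y2, ← neg_sub (y1 : ℂ) y3, ← neg_sub (y2 : ℂ) y3]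
    field_simp
    ring
  rw [e, mul_add, mul_add]
  refine (norm_add₃_le).trans ?_
  simp only [norm_mul, norm_div, Complex.norm_real, Real.norm_eq_abs]
  refine add_le_add (add_le_add ?_ ?_) ?_
  all_goals
    rw [mul_comm]
    refine mul_le_mul_of_nonneg_right ?_ (by positivity)
    rw [abs_le]
    constructor <;> linarith

/-- Comparison of one term of the weighted sums, when the weight `W` is at most `c w`. -/
lemma div_le_of_norm_le {m m' d E K w W c : ℝ} (hm : 0 ≤ m) (hw : 1 ≤ w) (hW : 0 < W)
    (hwW : w ≤ c * W) (hK : 0 ≤ K) (hd : d ≤ E * w) (hle : m ≤ m' + 3 * d + 9 * K) :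
    m / W ≤ c * (m' / w + 3 * E + 9 * K) := by
  have hw0 : 0 < w := by linarith
  have hc : 0 < c := by
    by_contra! hc
    nlinarith
  rw [div_le_iff₀ hW]
  have h1 : m ≤ w * (m' / w + 3 * E + 9 * K) := by
    have : w * (m' / w) = m' := by field_simp
    nlinarith
  have h2 : 0 ≤ m' / w + 3 * E + 9 * K := by
    by_contra! hneg
    nlinarith
  nlinarith [mul_le_mul_of_nonneg_right hwW h2]

lemma mul_abs_add_one_le {x1 x2 x3 y1 y2 y3 : ℝ}
    (h1 : |y1 - x1| ≤ 3) (h2 : |y2 - x2| ≤ 3) (h3 : |y3 - x3| ≤ 3)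
    (hd2 : 1 ≤ |y1 - y2|) (hd3 : 1 ≤ |y1 - y3|) :
    (|x1 - x2| + 1) * (|x1 - x3| + 1) ≤ 64 * (|y1 - y2| * |y1 - y3|) := by
  have a : ∀ {u v p q : ℝ}, |p - u| ≤ 3 → |q - v| ≤ 3 → 1 ≤ |p - q| →
      |u - v| + 1 ≤ 8 * |p - q| := by
    intro u v p q hp hq hpq
    have : |u - v| ≤ |p - q| + |p - u| + |q - v| := by
      calc |u - v| = |(p - q) - (p - u) + (q - v)| := by ring_nf
        _ ≤ |(p - q) - (p - u)| + |q - v| := abs_add_le _ _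
        _ ≤ _ := by gcongr; exact abs_sub _ _
    linarith
  calc _ ≤ (8 * |y1 - y2|) * (8 * |y1 - y3|) :=
        mul_le_mul (a h1 h2 hd2) (a h1 h3 hd3) (by positivity) (by positivity)
    _ = _ := by ring

lemma mul_abs_le_mul_abs_add_one {x1 x2 x3 y1 y2 y3 : ℝ}
    (h1 : |y1 - x1| ≤ 3) (h2 : |y2 - x2| ≤ 3) (h3 : |y3 - x3| ≤ 3) :
    |y1 - y2| * |y1 - y3| ≤ 36 * ((|x1 - x2| + 1) * (|x1 - x3| + 1)) := by
  have a : ∀ {u v p q : ℝ}, |p - u| ≤ 3 → |q - v| ≤ 3 →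
      |p - q| ≤ 6 * (|u - v| + 1) := by
    intro u v p q hp hq
    have : |p - q| ≤ |u - v| + |p - u| + |q - v| := by
      calc |p - q| = |(u - v) + (p - u) - (q - v)| := by ring_nf
        _ ≤ |(u - v) + (p - u)| + |q - v| := abs_sub _ _
        _ ≤ _ := by gcongr; exact abs_add_le _ _
    linarith [abs_nonneg (u - v)]
  calc _ ≤ (6 * (|x1 - x2| + 1)) * (6 * (|x1 - x3| + 1)) :=
        mul_le_mul (a h1 h2) (a h1 h3) (by positivity) (by positivity)
    _ = _ := by ring

section Pointwise

variable {b0 b1 b2 : ℂ} {K x1 x2 x3 y1 y2 y3 : ℝ}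

lemma separated_sum_le (hK : ‖b2‖ ≤ K) (hx12 : x1 ≤ x2) (hx23 : x2 ≤ x3)
    (h1 : |y1 - x1| ≤ 3) (h2 : |y2 - x2| ≤ 3) (h3 : |y3 - x3| ≤ 3)
    (hy12 : 1 ≤ y2 - y1) (hy23 : 1 ≤ y3 - y2) :
    ‖b0 + b1 * (y1 : ℂ) + b2 * (y1 : ℂ) ^ 2‖ / (|y1 - y2| * |y1 - y3|)
        + ‖b0 + b1 * (y2 : ℂ) + b2 * (y2 : ℂ) ^ 2‖ / (|y2 - y3| * |y2 - y1|)
        + ‖b0 + b1 * (y3 : ℂ) + b2 * (y3 : ℂ) ^ 2‖ / (|y3 - y1| * |y3 - y2|)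
      ≤ 2000 * ((‖b0 + b1 * (x1 : ℂ) + b2 * (x1 : ℂ) ^ 2‖ / ((|x1 - x2| + 1) * (|x1 - x3| + 1))
        + ‖b0 + b1 * (x2 : ℂ) + b2 * (x2 : ℂ) ^ 2‖ / ((|x2 - x3| + 1) * (|x2 - x1| + 1))
        + ‖b0 + b1 * (x3 : ℂ) + b2 * (x3 : ℂ) ^ 2‖ / ((|x3 - x1| + 1) * (|x3 - x2| + 1)))
        + (‖b1 + 2 * b2 * (x1 : ℂ)‖ + ‖b1 + 2 * b2 * (x3 : ℂ)‖) / (|x1 - x3| + 1) + K) := by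
  have hK0 : 0 ≤ K := (norm_nonneg _).trans hK
  have a12 : 1 ≤ |y1 - y2| := by rw [abs_sub_comm]; exact hy12.trans (le_abs_self _)
  have a23 : 1 ≤ |y2 - y3| := by rw [abs_sub_comm]; exact hy23.trans (le_abs_self _)
  have a13 : 1 ≤ |y1 - y3| := by
    rw [abs_sub_comm]; exact le_trans (by linarith) (le_abs_self _)
  have a21 := a12; have a32 := a23; have a31 := a13
  rw [abs_sub_comm] at a21 a32 a31
  have hH0 : 0 ≤ (‖b1 + 2 * b2 * (x1 : ℂ)‖ + ‖b1 + 2 * b2 * (x3 : ℂ)‖) / (|x1 - x3| + 1) := by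
    positivity
  set H := (‖b1 + 2 * b2 * (x1 : ℂ)‖ + ‖b1 + 2 * b2 * (x3 : ℂ)‖) / (|x1 - x3| + 1) with hH
  have hHm : ‖b1 + 2 * b2 * (x1 : ℂ)‖ + ‖b1 + 2 * b2 * (x3 : ℂ)‖ = H * (|x1 - x3| + 1) := by
    rw [hH]; field_simp
  have hd : ∀ {x w : ℝ}, x1 ≤ x → x ≤ x3 → |x1 - x3| + 1 ≤ w →
      ‖b1 + 2 * b2 * (x : ℂ)‖ ≤ H * w := by
    intro x w hx hx' hw
    refine (norm_affine_le_add hx hx').trans ?_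
    rw [hHm]
    gcongr
  have hw : ∀ a b c : ℝ, |b - c| + 1 ≤ (|a - b| + 1) * (|a - c| + 1) := by
    intro a b c
    have : |b - c| ≤ |a - b| + |a - c| := by
      rw [abs_sub_comm a b]; exact abs_sub_le b a c
    nlinarith [mul_nonneg (abs_nonneg (a - b)) (abs_nonneg (a - c))]
  have hw' : ∀ a b : ℝ, ∀ c, |a - b| + 1 ≤ (|a - b| + 1) * (|a - c| + 1) := by
    intro a b c
    nlinarith [mul_nonneg (abs_nonneg (a - b)) (abs_nonneg (a - c)), abs_nonneg (a - c)]
  have hone : ∀ a b : ℝ, 1 ≤ (|a| + 1) * (|b| + 1) := fun a b => by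
    nlinarith [mul_nonneg (abs_nonneg a) (abs_nonneg b), abs_nonneg a, abs_nonneg b]
  have t1 := div_le_of_norm_le (norm_nonneg _) (hone (x1 - x2) (x1 - x3))
    (by positivity : 0 < |y1 - y2| * |y1 - y3|) (mul_abs_add_one_le h1 h2 h3 a12 a13) hK0
    (hd le_rfl (hx12.trans hx23) (by rw [mul_comm]; exact hw' _ _ _))
    (norm_quadratic_le (b0 := b0) (b1 := b1) hK h1)
  have t2 := div_le_of_norm_le (norm_nonneg _) (hone (x2 - x3) (x2 - x1))
    (by positivity : 0 < |y2 - y3| * |y2 - y1|) (mul_abs_add_one_le h2 h3 h1 a23 a21) hK0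
    (hd hx12 hx23 (by rw [abs_sub_comm x1 x3]; exact hw _ _ _))
    (norm_quadratic_le (b0 := b0) (b1 := b1) hK h2)
  have t3 := div_le_of_norm_le (norm_nonneg _) (hone (x3 - x1) (x3 - x2))
    (by positivity : 0 < |y3 - y1| * |y3 - y2|) (mul_abs_add_one_le h3 h1 h2 a31 a32) hK0
    (hd (hx12.trans hx23) le_rfl (by rw [abs_sub_comm x1 x3]; exact hw' _ _ _))
    (norm_quadratic_le (b0 := b0) (b1 := b1) hK h3)
  have p1 : 0 ≤ ‖b0 + b1 * (x1 : ℂ) + b2 * (x1 : ℂ) ^ 2‖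
    / ((|x1 - x2| + 1) * (|x1 - x3| + 1)) := by positivity
  have p2 : 0 ≤ ‖b0 + b1 * (x2 : ℂ) + b2 * (x2 : ℂ) ^ 2‖
    / ((|x2 - x3| + 1) * (|x2 - x1| + 1)) := by positivity
  have p3 : 0 ≤ ‖b0 + b1 * (x3 : ℂ) + b2 * (x3 : ℂ) ^ 2‖
    / ((|x3 - x1| + 1) * (|x3 - x2| + 1)) := by positivity
  linarith

lemma sum_le_separated (hK : ‖b2‖ ≤ K)
    (h1 : |y1 - x1| ≤ 3) (h2 : |y2 - x2| ≤ 3) (h3 : |y3 - x3| ≤ 3)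
    (hy12 : 1 ≤ y2 - y1) (hy23 : 1 ≤ y3 - y2) :
    ‖b0 + b1 * (x1 : ℂ) + b2 * (x1 : ℂ) ^ 2‖ / ((|x1 - x2| + 1) * (|x1 - x3| + 1))
        + ‖b0 + b1 * (x2 : ℂ) + b2 * (x2 : ℂ) ^ 2‖ / ((|x2 - x3| + 1) * (|x2 - x1| + 1))
        + ‖b0 + b1 * (x3 : ℂ) + b2 * (x3 : ℂ) ^ 2‖ / ((|x3 - x1| + 1) * (|x3 - x2| + 1))
      ≤ 2000 * ((‖b0 + b1 * (y1 : ℂ) + b2 * (y1 : ℂ) ^ 2‖ / (|y1 - y2| * |y1 - y3|)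
        + ‖b0 + b1 * (y2 : ℂ) + b2 * (y2 : ℂ) ^ 2‖ / (|y2 - y3| * |y2 - y1|)
        + ‖b0 + b1 * (y3 : ℂ) + b2 * (y3 : ℂ) ^ 2‖ / (|y3 - y1| * |y3 - y2|)) + K) := by
  have hK0 : 0 ≤ K := (norm_nonneg _).trans hK
  have hder : ∀ {z : ℝ}, y1 ≤ z → z ≤ y3 → _ := fun {z} hz hz' =>
    norm_quadratic_deriv_le_interpolation (b0 := b0) (b1 := b1) (b2 := b2) (z := z)
      (by linarith : y1 < y2) (by linarith : y2 < y3) hz hz'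
  have p1 : 0 ≤ ‖b0 + b1 * (y1 : ℂ) + b2 * (y1 : ℂ) ^ 2‖ / (|y1 - y2| * |y1 - y3|) := by
    positivity
  have p2 : 0 ≤ ‖b0 + b1 * (y2 : ℂ) + b2 * (y2 : ℂ) ^ 2‖ / (|y2 - y3| * |y2 - y1|) := by
    positivity
  have p3 : 0 ≤ ‖b0 + b1 * (y3 : ℂ) + b2 * (y3 : ℂ) ^ 2‖ / (|y3 - y1| * |y3 - y2|) := by
    positivity
  have a12 : |y1 - y2| = y2 - y1 := by rw [abs_sub_comm]; exact abs_of_nonneg (by linarith)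
  have a23 : |y2 - y3| = y3 - y2 := by rw [abs_sub_comm]; exact abs_of_nonneg (by linarith)
  have a13 : |y1 - y3| = y3 - y1 := by rw [abs_sub_comm]; exact abs_of_nonneg (by linarith)
  have a21 := a12; have a32 := a23; have a31 := a13
  rw [abs_sub_comm] at a21 a32 a31
  set F := ‖b0 + b1 * (y1 : ℂ) + b2 * (y1 : ℂ) ^ 2‖ / (|y1 - y2| * |y1 - y3|)
        + ‖b0 + b1 * (y2 : ℂ) + b2 * (y2 : ℂ) ^ 2‖ / (|y2 - y3| * |y2 - y1|)
        + ‖b0 + b1 * (y3 : ℂ) + b2 * (y3 : ℂ) ^ 2‖ / (|y3 - y1| * |y3 - y2|) with hF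
  have hF0 : 0 ≤ F := by positivity
  have hd : ∀ {z w : ℝ}, y1 ≤ z → z ≤ y3 → y3 - y1 ≤ 2 * w →
      ‖b1 + 2 * b2 * (z : ℂ)‖ ≤ 4 * F * w := by
    intro z w hz hz' hw
    refine (hder hz hz').trans ?_
    nlinarith
  have n := fun {x y : ℝ} (h : |y - x| ≤ 3) =>
    norm_quadratic_le (b0 := b0) (b1 := b1) hK (by rwa [abs_sub_comm] : |x - y| ≤ 3)
  have t1 := div_le_of_norm_le (norm_nonneg _) (by rw [a12, a13]; nlinarith)
    (by positivity : 0 < (|x1 - x2| + 1) * (|x1 - x3| + 1))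
    (mul_abs_le_mul_abs_add_one h1 h2 h3) hK0
    (hd le_rfl (by linarith) (by rw [a12, a13]; nlinarith)) (n h1)
  have t2 := div_le_of_norm_le (norm_nonneg _) (by rw [a23, a21]; nlinarith)
    (by positivity : 0 < (|x2 - x3| + 1) * (|x2 - x1| + 1))
    (mul_abs_le_mul_abs_add_one h2 h3 h1) hK0
    (hd (by linarith) (by linarith) (by rw [a23, a21]; nlinarith)) (n h2)
  have t3 := div_le_of_norm_le (norm_nonneg _) (by rw [a31, a32]; nlinarith)
    (by positivity : 0 < (|x3 - x1| + 1) * (|x3 - x2| + 1))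
    (mul_abs_le_mul_abs_add_one h3 h1 h2) hK0
    (hd (by linarith) le_rfl (by rw [a31, a32]; nlinarith)) (n h3)
  linarith

lemma deriv_sum_le_separated (hK : ‖b2‖ ≤ K)
    (h1 : |y1 - x1| ≤ 3) (h3 : |y3 - x3| ≤ 3)
    (hy12 : 1 ≤ y2 - y1) (hy23 : 1 ≤ y3 - y2) :
    (‖b1 + 2 * b2 * (x1 : ℂ)‖ + ‖b1 + 2 * b2 * (x3 : ℂ)‖) / (|x1 - x3| + 1)
      ≤ 2000 * ((‖b0 + b1 * (y1 : ℂ) + b2 * (y1 : ℂ) ^ 2‖ / (|y1 - y2| * |y1 - y3|)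
        + ‖b0 + b1 * (y2 : ℂ) + b2 * (y2 : ℂ) ^ 2‖ / (|y2 - y3| * |y2 - y1|)
        + ‖b0 + b1 * (y3 : ℂ) + b2 * (y3 : ℂ) ^ 2‖ / (|y3 - y1| * |y3 - y2|)) + K) := by
  have hK0 : 0 ≤ K := (norm_nonneg _).trans hK
  have hder : ∀ {z : ℝ}, y1 ≤ z → z ≤ y3 → _ := fun {z} hz hz' =>
    norm_quadratic_deriv_le_interpolation (b0 := b0) (b1 := b1) (b2 := b2) (z := z)
      (by linarith : y1 < y2) (by linarith : y2 < y3) hz hz'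
  have e1 := hder le_rfl (by linarith)
  have e3 := hder (by linarith) le_rfl
  have d1 := norm_quadratic_deriv_le (b1 := b1) hK (by rwa [abs_sub_comm] : |x1 - y1| ≤ 3)
  have d3 := norm_quadratic_deriv_le (b1 := b1) hK (by rwa [abs_sub_comm] : |x3 - y3| ≤ 3)
  set F := ‖b0 + b1 * (y1 : ℂ) + b2 * (y1 : ℂ) ^ 2‖ / (|y1 - y2| * |y1 - y3|)
        + ‖b0 + b1 * (y2 : ℂ) + b2 * (y2 : ℂ) ^ 2‖ / (|y2 - y3| * |y2 - y1|)
        + ‖b0 + b1 * (y3 : ℂ) + b2 * (y3 : ℂ) ^ 2‖ / (|y3 - y1| * |y3 - y2|) with hF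
  have hF0 : 0 ≤ F := by positivity
  rw [div_le_iff₀ (by positivity)]
  have hD : y3 - y1 ≤ |x1 - x3| + 6 := by
    have := neg_abs_le (x1 - x3)
    rw [abs_le] at h1 h3
    linarith [h1.1, h3.2]
  have hDF := mul_le_mul_of_nonneg_right hD hF0
  nlinarith [mul_nonneg hF0 (abs_nonneg (x1 - x3)), mul_nonneg hK0 (abs_nonneg (x1 - x3))]

end Pointwise

/-- The ordered real roots of a cubic depend continuously on its coefficients. -/
lemma continuousOn_ordered_cubic_roots {S : Set ℝ} (hS : IsCompact S) {a1 a2 a3 x1 x2 x3 : ℝ → ℝ}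
    (ha1 : ContinuousOn a1 S) (ha2 : ContinuousOn a2 S) (ha3 : ContinuousOn a3 S)
    (hfac : ∀ t ∈ S, ∀ τ : ℝ, τ ^ 3 + a1 t * τ ^ 2 + a2 t * τ + a3 t
      = (τ - x1 t) * (τ - x2 t) * (τ - x3 t))
    (hord : ∀ t ∈ S, x1 t ≤ x2 t ∧ x2 t ≤ x3 t) :
    ContinuousOn x1 S ∧ ContinuousOn x2 S ∧ ContinuousOn x3 S := by
  have v1 : ∀ t ∈ S, x1 t + x2 t + x3 t = - a1 t := fun t ht => by
    linarith [hfac t ht 0, hfac t ht 1, hfac t ht (-1)]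
  have v2 : ∀ t ∈ S, x1 t * x2 t + x1 t * x3 t + x2 t * x3 t = a2 t := fun t ht => by
    linarith [hfac t ht 0, hfac t ht 1, hfac t ht (-1)]
  have v3 : ∀ t ∈ S, x1 t * x2 t * x3 t = - a3 t := fun t ht => by
    linarith [hfac t ht 0]
  obtain ⟨C, hC⟩ := hS.exists_bound_of_continuousOn
    (f := fun t => a1 t ^ 2 - 2 * a2 t) (by fun_prop)
  have hsq : ∀ t ∈ S, x1 t ^ 2 + x2 t ^ 2 + x3 t ^ 2 ≤ C := fun t ht => by
    refine le_trans (le_of_eq ?_) ((le_abs_self _).trans (hC t ht))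
    rw [← v2 t ht, ← neg_sq (a1 t), ← v1 t ht]
    ring
  let X : Set (ℝ × ℝ × ℝ) :=
    {p | p.1 ≤ p.2.1 ∧ p.2.1 ≤ p.2.2} ∩ (Icc (-(C + 1)) (C + 1) ×ˢ
      Icc (-(C + 1)) (C + 1) ×ˢ Icc (-(C + 1)) (C + 1))
  have hX : IsCompact X := by
    refine IsCompact.inter_left (isCompact_Icc.prod (isCompact_Icc.prod isCompact_Icc)) ?_
    exact (isClosed_le continuous_fst continuous_snd.fst).inter
      (isClosed_le continuous_snd.fst continuous_snd.snd)
  have : CompactSpace X := isCompact_iff_compactSpace.1 hX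
  let e : X → ℝ × ℝ × ℝ := fun p =>
    (p.1.1 + p.1.2.1 + p.1.2.2, p.1.1 * p.1.2.1 + p.1.1 * p.1.2.2 + p.1.2.1 * p.1.2.2,
      p.1.1 * p.1.2.1 * p.1.2.2)
  have hec : Continuous e := by fun_prop
  have hei : Function.Injective e := by
    rintro ⟨⟨u1, u2, u3⟩, ⟨⟨hu12, hu23⟩, hu⟩⟩ ⟨⟨w1, w2, w3⟩, ⟨⟨hw12, hw23⟩, hw⟩⟩ h
    simp only [e, Prod.mk.injEq] at h hu12 hu23 hw12 hw23
    obtain ⟨g1, g2, g3⟩ := h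
    have hprod : ∀ τ : ℝ, (τ - u1) * (τ - u2) * (τ - u3) = (τ - w1) * (τ - w2) * (τ - w3) := by
      intro τ
      linear_combination (-τ ^ 2) * g1 + τ * g2 - g3
    have aux : ∀ {a b c d : ℝ}, (d - a) * (d - b) * (d - c) = 0 → d = a ∨ d = b ∨ d = c := by
      intro a b c d h
      rcases mul_eq_zero.1 h with h | h
      · rcases mul_eq_zero.1 h with h | h
        · exact Or.inl (sub_eq_zero.1 h)
        · exact Or.inr (Or.inl (sub_eq_zero.1 h))
      · exact Or.inr (Or.inr (sub_eq_zero.1 h))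
    have k1 : w1 = u1 := by
      apply le_antisymm
      · rcases aux ((hprod u1).symm.trans (by ring)) with h | h | h <;> linarith
      · rcases aux ((hprod w1).trans (by ring)) with h | h | h <;> linarith
    have k3 : w3 = u3 := by
      apply le_antisymm
      · rcases aux ((hprod w3).trans (by ring)) with h | h | h <;> linarith
      · rcases aux ((hprod u3).symm.trans (by ring)) with h | h | h <;> linarith
    have k2 : w2 = u2 := by linarith
    simp only [k1, k2, k3]
  have hemb := (hec.isClosedEmbedding hei).isEmbedding
  have hmem : ∀ t : S, (x1 t, x2 t, x3 t) ∈ X := by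
    rintro ⟨t, ht⟩
    have := hsq t ht
    refine ⟨hord t ht, ?_, ?_, ?_⟩ <;> constructor <;>
      nlinarith [sq_nonneg (x1 t), sq_nonneg (x2 t), sq_nonneg (x3 t),
        sq_nonneg (x1 t - 1), sq_nonneg (x1 t + 1), sq_nonneg (x2 t - 1),
        sq_nonneg (x2 t + 1), sq_nonneg (x3 t - 1), sq_nonneg (x3 t + 1)]
  let g : S → X := fun t => ⟨(x1 t, x2 t, x3 t), hmem t⟩
  have hg : Continuous g := by
    rw [hemb.continuous_iff]
    have : e ∘ g = fun t : S => (- a1 t, a2 t, - a3 t) := by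
      funext t
      simp only [e, g, Function.comp, v1 t t.2, v2 t t.2, v3 t t.2]
    rw [this]
    rw [continuousOn_iff_continuous_domRestrict] at ha1 ha2 ha3
    exact ha1.neg.prodMk (ha2.prodMk ha3.neg)
  have hg' : Continuous fun t : S => (x1 t, x2 t, x3 t) := continuous_subtype_val.comp hg
  simp only [continuousOn_iff_continuous_domRestrict]
  exact ⟨hg'.fst, hg'.snd.fst, hg'.snd.snd⟩

lemma intervalIntegral_le_of_le_mul_add {T c K : ℝ} (hT : 0 ≤ T) {f g : ℝ → ℝ}
    (hf : ContinuousOn f (Icc 0 T)) (hg : ContinuousOn g (Icc 0 T))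
    (h : ∀ t ∈ Icc 0 T, f t ≤ c * (g t + K)) :
    ∫ t in (0 : ℝ)..T, f t ≤ c * ((∫ t in (0 : ℝ)..T, g t) + K * T) := by
  have hgi : IntervalIntegrable g volume 0 T := hg.intervalIntegrable_of_Icc hT
  have hi := intervalIntegral.integral_mono_on hT (hf.intervalIntegrable_of_Icc hT)
    ((hgi.add intervalIntegrable_const).const_mul c) h
  refine hi.trans (le_of_eq ?_)
  rw [intervalIntegral.integral_const_mul, intervalIntegral.integral_add hgi
    intervalIntegrable_const, intervalIntegral.integral_const]
  simp [mul_comm]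

/-- Proposition on the Levi condition for the second-order terms: for a weakly hyperbolic
monic cubic symbol `L(t,τ,ξ) = τ³ + A1τ² + A2τ + A3` with real roots `τ1 ≤ τ2 ≤ τ3` and
auxiliary cubic `𝓛 = L - ∂²_τ L` with real distinct roots `λ1 < λ2 < λ3`, and for
`M̌(t,τ,ξ) = B0 + B1 τ + B2 τ²` with `|B2| ≤ K`, the logarithmic condition over the cyclic
triples `S3` for `M̌` evaluated at the `λ_j` is equivalent to the pair of logarithmic
conditions for `M̌` and `∂_τ M̌` evaluated at the `τ_j`. -/
theorem stmt_0
    (n : ℕ) (hn : 1 ≤ n) (T R : ℝ) (hT : 0 < T) (hR : 0 < R)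
    (A1 A2 A3 : ℝ → EuclideanSpace ℝ (Fin n) → ℝ)
    (hA1 : ContinuousOn (fun p : ℝ × EuclideanSpace ℝ (Fin n) => A1 p.1 p.2)
      (Icc 0 T ×ˢ {ξ : EuclideanSpace ℝ (Fin n) | R ≤ ‖ξ‖}))
    (hA2 : ContinuousOn (fun p : ℝ × EuclideanSpace ℝ (Fin n) => A2 p.1 p.2)
      (Icc 0 T ×ˢ {ξ : EuclideanSpace ℝ (Fin n) | R ≤ ‖ξ‖}))
    (hA3 : ContinuousOn (fun p : ℝ × EuclideanSpace ℝ (Fin n) => A3 p.1 p.2)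
      (Icc 0 T ×ˢ {ξ : EuclideanSpace ℝ (Fin n) | R ≤ ‖ξ‖}))
    (τ1 τ2 τ3 lam1 lam2 lam3 : ℝ → EuclideanSpace ℝ (Fin n) → ℝ)
    (hτfac : ∀ t ∈ Icc (0 : ℝ) T, ∀ ξ : EuclideanSpace ℝ (Fin n), R ≤ ‖ξ‖ →
      ∀ τ : ℝ, τ ^ 3 + A1 t ξ * τ ^ 2 + A2 t ξ * τ + A3 t ξ
        = (τ - τ1 t ξ) * (τ - τ2 t ξ) * (τ - τ3 t ξ))
    (hτord : ∀ t ∈ Icc (0 : ℝ) T, ∀ ξ : EuclideanSpace ℝ (Fin n), R ≤ ‖ξ‖ →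
      τ1 t ξ ≤ τ2 t ξ ∧ τ2 t ξ ≤ τ3 t ξ)
    (hlamfac : ∀ t ∈ Icc (0 : ℝ) T, ∀ ξ : EuclideanSpace ℝ (Fin n), R ≤ ‖ξ‖ →
      ∀ τ : ℝ,
        τ ^ 3 + A1 t ξ * τ ^ 2 + A2 t ξ * τ + A3 t ξ - (6 * τ + 2 * A1 t ξ)
          = (τ - lam1 t ξ) * (τ - lam2 t ξ) * (τ - lam3 t ξ))
    (hlamord : ∀ t ∈ Icc (0 : ℝ) T, ∀ ξ : EuclideanSpace ℝ (Fin n), R ≤ ‖ξ‖ →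
      lam1 t ξ < lam2 t ξ ∧ lam2 t ξ < lam3 t ξ)
    (B0 B1 B2 : ℝ → EuclideanSpace ℝ (Fin n) → ℂ)
    (hB0 : ContinuousOn (fun p : ℝ × EuclideanSpace ℝ (Fin n) => B0 p.1 p.2)
      (Icc 0 T ×ˢ {ξ : EuclideanSpace ℝ (Fin n) | R ≤ ‖ξ‖}))
    (hB1 : ContinuousOn (fun p : ℝ × EuclideanSpace ℝ (Fin n) => B1 p.1 p.2)
      (Icc 0 T ×ˢ {ξ : EuclideanSpace ℝ (Fin n) | R ≤ ‖ξ‖}))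
    (hB2 : ContinuousOn (fun p : ℝ × EuclideanSpace ℝ (Fin n) => B2 p.1 p.2)
      (Icc 0 T ×ˢ {ξ : EuclideanSpace ℝ (Fin n) | R ≤ ‖ξ‖}))
    (K : ℝ)
    (hK : ∀ t ∈ Icc (0 : ℝ) T, ∀ ξ : EuclideanSpace ℝ (Fin n), R ≤ ‖ξ‖ → ‖B2 t ξ‖ ≤ K)
    (Mc dMc : ℝ → EuclideanSpace ℝ (Fin n) → ℝ → ℂ)
    (hMc : ∀ t ξ τ, Mc t ξ τ = B0 t ξ + B1 t ξ * (τ : ℂ) + B2 t ξ * (τ : ℂ) ^ 2)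
    (hdMc : ∀ t ξ τ, dMc t ξ τ = B1 t ξ + 2 * B2 t ξ * (τ : ℂ)) :
    (∃ C > (0 : ℝ), ∀ ξ : EuclideanSpace ℝ (Fin n), R ≤ ‖ξ‖ →
      ∫ t in (0 : ℝ)..T,
        (‖Mc t ξ (lam1 t ξ)‖ / (|lam1 t ξ - lam2 t ξ| * |lam1 t ξ - lam3 t ξ|)
          + ‖Mc t ξ (lam2 t ξ)‖ / (|lam2 t ξ - lam3 t ξ| * |lam2 t ξ - lam1 t ξ|)
          + ‖Mc t ξ (lam3 t ξ)‖ / (|lam3 t ξ - lam1 t ξ| * |lam3 t ξ - lam2 t ξ|))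
        ≤ C * Real.log (1 + ‖ξ‖))
    ↔
    (∃ C > (0 : ℝ), ∀ ξ : EuclideanSpace ℝ (Fin n), R ≤ ‖ξ‖ →
      (∫ t in (0 : ℝ)..T,
        (‖Mc t ξ (τ1 t ξ)‖ / ((|τ1 t ξ - τ2 t ξ| + 1) * (|τ1 t ξ - τ3 t ξ| + 1))
          + ‖Mc t ξ (τ2 t ξ)‖ / ((|τ2 t ξ - τ3 t ξ| + 1) * (|τ2 t ξ - τ1 t ξ| + 1))
          + ‖Mc t ξ (τ3 t ξ)‖ / ((|τ3 t ξ - τ1 t ξ| + 1) * (|τ3 t ξ - τ2 t ξ| + 1)))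
        ≤ C * Real.log (1 + ‖ξ‖))
      ∧
      (∫ t in (0 : ℝ)..T,
        (‖dMc t ξ (τ1 t ξ)‖ + ‖dMc t ξ (τ3 t ξ)‖) / (|τ1 t ξ - τ3 t ξ| + 1)
        ≤ C * Real.log (1 + ‖ξ‖))) := by
  simp only [hMc, hdMc]
  have roots : ∀ t ∈ Icc (0 : ℝ) T, ∀ ξ : EuclideanSpace ℝ (Fin n), R ≤ ‖ξ‖ →
      (|lam1 t ξ - τ1 t ξ| ≤ 3 ∧ |lam2 t ξ - τ2 t ξ| ≤ 3 ∧ |lam3 t ξ - τ3 t ξ| ≤ 3) ∧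
        1 ≤ lam2 t ξ - lam1 t ξ ∧ 1 ≤ lam3 t ξ - lam2 t ξ := by
    intro t ht ξ hξ
    have hf := hτfac t ht ξ hξ
    have hl := hlamfac t ht ξ hξ
    have hsum : A1 t ξ = -(τ1 t ξ + τ2 t ξ + τ3 t ξ) := by
      linarith [hf 0, hf 1, hf (-1)]
    refine cubic_sub_second_deriv_roots (hτord t ht ξ hξ).1 (hτord t ht ξ hξ).2
      (hlamord t ht ξ hξ).1 (hlamord t ht ξ hξ).2 fun τ => ?_
    rw [← hl τ, ← hf τ, hsum]
    ring
  have hB2K : ∀ t ∈ Icc (0 : ℝ) T, ∀ ξ : EuclideanSpace ℝ (Fin n), R ≤ ‖ξ‖ → ‖B2 t ξ‖ ≤ |K| :=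
    fun t ht ξ hξ => (hK t ht ξ hξ).trans (le_abs_self K)
  have slice : ∀ {E : Type} [TopologicalSpace E] {f : ℝ → EuclideanSpace ℝ (Fin n) → E},
      ContinuousOn (fun p : ℝ × EuclideanSpace ℝ (Fin n) => f p.1 p.2)
        (Icc 0 T ×ˢ {ξ : EuclideanSpace ℝ (Fin n) | R ≤ ‖ξ‖}) →
      ∀ ξ : EuclideanSpace ℝ (Fin n), R ≤ ‖ξ‖ → ContinuousOn (fun t => f t ξ) (Icc 0 T) :=
    fun hf ξ hξ => hf.comp (f := fun t => (t, ξ)) (by fun_prop) fun t ht => ⟨ht, hξ⟩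
  have contτ := fun (ξ : EuclideanSpace ℝ (Fin n)) (hξ : R ≤ ‖ξ‖) =>
    continuousOn_ordered_cubic_roots isCompact_Icc (slice hA1 ξ hξ) (slice hA2 ξ hξ)
      (slice hA3 ξ hξ) (fun t ht => hτfac t ht ξ hξ) (fun t ht => hτord t ht ξ hξ)
  have contlam := fun (ξ : EuclideanSpace ℝ (Fin n)) (hξ : R ≤ ‖ξ‖) =>
    continuousOn_ordered_cubic_roots (a2 := fun t => A2 t ξ - 6)
      (a3 := fun t => A3 t ξ - 2 * A1 t ξ) isCompact_Icc (slice hA1 ξ hξ)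
      ((slice hA2 ξ hξ).sub continuousOn_const)
      ((slice hA3 ξ hξ).sub (continuousOn_const.mul (slice hA1 ξ hξ)))
      (fun t ht τ => by rw [← hlamfac t ht ξ hξ τ]; ring)
      (fun t ht => ⟨(hlamord t ht ξ hξ).1.le, (hlamord t ht ξ hξ).2.le⟩)
  have contF : ∀ ξ : EuclideanSpace ℝ (Fin n), R ≤ ‖ξ‖ → ContinuousOn (fun t =>
      ‖B0 t ξ + B1 t ξ * (lam1 t ξ : ℂ) + B2 t ξ * (lam1 t ξ : ℂ) ^ 2‖
          / (|lam1 t ξ - lam2 t ξ| * |lam1 t ξ - lam3 t ξ|)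
        + ‖B0 t ξ + B1 t ξ * (lam2 t ξ : ℂ) + B2 t ξ * (lam2 t ξ : ℂ) ^ 2‖
          / (|lam2 t ξ - lam3 t ξ| * |lam2 t ξ - lam1 t ξ|)
        + ‖B0 t ξ + B1 t ξ * (lam3 t ξ : ℂ) + B2 t ξ * (lam3 t ξ : ℂ) ^ 2‖
          / (|lam3 t ξ - lam1 t ξ| * |lam3 t ξ - lam2 t ξ|)) (Icc 0 T) := by
    intro ξ hξ
    obtain ⟨c1, c2, c3⟩ := contlam ξ hξ
    have d0 := slice hB0 ξ hξ
    have d1 := slice hB1 ξ hξ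
    have d2 := slice hB2 ξ hξ
    refine ((ContinuousOn.div (by fun_prop) (by fun_prop) ?_).add
      (ContinuousOn.div (by fun_prop) (by fun_prop) ?_)).add
      (ContinuousOn.div (by fun_prop) (by fun_prop) ?_)
    all_goals
      intro t ht
      obtain ⟨o1, o2⟩ := hlamord t ht ξ hξ
      refine mul_ne_zero (abs_ne_zero.2 (sub_ne_zero.2 ?_)) (abs_ne_zero.2 (sub_ne_zero.2 ?_)) <;>
        intro h <;> linarith
  have contG : ∀ ξ : EuclideanSpace ℝ (Fin n), R ≤ ‖ξ‖ → ContinuousOn (fun t =>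
      ‖B0 t ξ + B1 t ξ * (τ1 t ξ : ℂ) + B2 t ξ * (τ1 t ξ : ℂ) ^ 2‖
          / ((|τ1 t ξ - τ2 t ξ| + 1) * (|τ1 t ξ - τ3 t ξ| + 1))
        + ‖B0 t ξ + B1 t ξ * (τ2 t ξ : ℂ) + B2 t ξ * (τ2 t ξ : ℂ) ^ 2‖
          / ((|τ2 t ξ - τ3 t ξ| + 1) * (|τ2 t ξ - τ1 t ξ| + 1))
        + ‖B0 t ξ + B1 t ξ * (τ3 t ξ : ℂ) + B2 t ξ * (τ3 t ξ : ℂ) ^ 2‖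
          / ((|τ3 t ξ - τ1 t ξ| + 1) * (|τ3 t ξ - τ2 t ξ| + 1))) (Icc 0 T) := by
    intro ξ hξ
    obtain ⟨c1, c2, c3⟩ := contτ ξ hξ
    have d0 := slice hB0 ξ hξ
    have d1 := slice hB1 ξ hξ
    have d2 := slice hB2 ξ hξ
    refine ((ContinuousOn.div (by fun_prop) (by fun_prop) ?_).add
      (ContinuousOn.div (by fun_prop) (by fun_prop) ?_)).add
      (ContinuousOn.div (by fun_prop) (by fun_prop) ?_)
    all_goals
      intro t ht
      positivity
  have contH : ∀ ξ : EuclideanSpace ℝ (Fin n), R ≤ ‖ξ‖ → ContinuousOn (fun t =>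
      (‖B1 t ξ + 2 * B2 t ξ * (τ1 t ξ : ℂ)‖ + ‖B1 t ξ + 2 * B2 t ξ * (τ3 t ξ : ℂ)‖)
        / (|τ1 t ξ - τ3 t ξ| + 1)) (Icc 0 T) := by
    intro ξ hξ
    obtain ⟨c1, c2, c3⟩ := contτ ξ hξ
    have d1 := slice hB1 ξ hξ
    have d2 := slice hB2 ξ hξ
    refine ContinuousOn.div (by fun_prop) (by fun_prop) fun t ht => ?_
    positivity
  have hlogR : 0 < Real.log (1 + R) := Real.log_pos (by linarith)
  have hlog : ∀ ξ : EuclideanSpace ℝ (Fin n), R ≤ ‖ξ‖ →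
      |K| * T ≤ |K| * T / Real.log (1 + R) * Real.log (1 + ‖ξ‖) := by
    intro ξ hξ
    rw [div_mul_eq_mul_div, le_div_iff₀ hlogR]
    have := Real.log_le_log (by linarith) (by linarith : 1 + R ≤ 1 + ‖ξ‖)
    gcongr
  constructor
  · rintro ⟨C, hC, h⟩
    refine ⟨2000 * (C + |K| * T / Real.log (1 + R)), by positivity, fun ξ hξ => ⟨?_, ?_⟩⟩
    · refine (intervalIntegral_le_of_le_mul_add (c := 2000) (K := |K|) hT.le (contG ξ hξ)
        (contF ξ hξ) fun t ht => ?_).trans ?_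
      · obtain ⟨⟨h1, h2, h3⟩, h12, h23⟩ := roots t ht ξ hξ
        exact sum_le_separated (hB2K t ht ξ hξ) h1 h2 h3 h12 h23
      · linarith [h ξ hξ, hlog ξ hξ]
    · refine (intervalIntegral_le_of_le_mul_add (c := 2000) (K := |K|) hT.le (contH ξ hξ)
        (contF ξ hξ) fun t ht => ?_).trans ?_
      · obtain ⟨⟨h1, h2, h3⟩, h12, h23⟩ := roots t ht ξ hξ
        exact deriv_sum_le_separated (hB2K t ht ξ hξ) h1 h3 h12 h23
      · linarith [h ξ hξ, hlog ξ hξ]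
  · rintro ⟨C, hC, h⟩
    refine ⟨2000 * (2 * C + |K| * T / Real.log (1 + R)), by positivity, fun ξ hξ => ?_⟩
    refine (intervalIntegral_le_of_le_mul_add (c := 2000) (K := |K|) hT.le (contF ξ hξ)
      ((contG ξ hξ).add (contH ξ hξ)) fun t ht => ?_).trans ?_
    · obtain ⟨⟨h1, h2, h3⟩, h12, h23⟩ := roots t ht ξ hξ
      obtain ⟨o1, o2⟩ := hτord t ht ξ hξ
      exact separated_sum_le (hB2K t ht ξ hξ) o1 o2 h1 h2 h3 h12 h23
    · obtain ⟨i1, i2⟩ := h ξ hξ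
      simp only [Pi.add_apply]
      rw [intervalIntegral.integral_add ((contG ξ hξ).intervalIntegrable_of_Icc hT.le)
        ((contH ξ hξ).intervalIntegrable_of_Icc hT.le)]
      linarith [hlog ξ hξ]
end

section
/- Let T>0, R>0, n≥1 and Ξ={ξ∈ℝⁿ : |ξ|≥R}. Let A1,A2:[0,T]×Ξ→ℝ be continuous with A1(t,ξ)²≥3A2(t,ξ) for all (t,ξ). Define σ1=(−A1−√(A1²−3A2))/3 and σ2=(−A1+√(A1²−3A2))/3 (the real roots of 3τ²+2A1τ+A2), and μ1=(−A1−√(A1²−3A2+18))/3 and μ2=(−A1+√(A1²−3A2+18))/3 (the real roots of 3τ²+2A1τ+A2−6). Let Ň(t,τ,ξ)=B0(t,ξ)+B1(t,ξ)τ where B0,B1:[0,T]×Ξ→ℂ are continuous and |B1(t,ξ)|≤K for all (t,ξ) and some constant K. Then the following are equivalent: (i) there exists C>0 such that for all ξ∈Ξ, ∫₀ᵀ Σ_{j=1,2} √( |Ň(t,μ_j(t,ξ),ξ)| / (μ2(t,ξ)−μ1(t,ξ)) ) dt ≤ C·log(1+|ξ|); (ii) there exists C>0 such that for all ξ∈Ξ,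 ∫₀ᵀ Σ_{j=1,2} √( |Ň(t,σ_j(t,ξ),ξ)| / (|σ2(t,ξ)−σ1(t,ξ)|+1) ) dt ≤ C·log(1+|ξ|). -/
open Set MeasureTheory

/-- Comparison of `√(a/p)` and `√(b/q)` for comparable denominators `p, q ≥ 1` and numerators
differing by a bounded amount. -/
lemma sqrt_div_le_two_mul_sqrt_div_add {a b p q L : ℝ} (hb : 0 ≤ b) (hL : 0 ≤ L)
    (hp : 1 ≤ p) (hq : 1 ≤ q) (hqp : q ≤ 3 * p) (hab : a ≤ b + L) :
    √(a / p) ≤ 2 * √(b / q) + √L := by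
  have hx : 0 ≤ b / q := by positivity
  have h : a / p ≤ 3 * (b / q) + L := by
    have hbp : b / p ≤ 3 * (b / q) := by
      rw [mul_div_assoc', div_le_div_iff₀ (by positivity) (by positivity)]
      nlinarith
    have hLp : L / p ≤ L := div_le_self hL hp
    calc a / p ≤ (b + L) / p := by gcongr
      _ = b / p + L / p := add_div _ _ _
      _ ≤ _ := by linarith
  refine Real.sqrt_le_iff.2 ⟨by positivity, h.trans ?_⟩
  nlinarith [Real.sq_sqrt hx, Real.sq_sqrt hL,
    mul_nonneg (Real.sqrt_nonneg (b / q)) (Real.sqrt_nonneg L)]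

/-- A logarithmic bound for the integrals of `f` passes to `g` when `g ≤ 2 f + M`. -/
lemma exists_integral_le_mul_log_of_le {E : Type*} [SeminormedAddCommGroup E] {T R M : ℝ}
    (hT : 0 ≤ T) (hR : 0 < R) (hM : 0 ≤ M) {f g : ℝ → E → ℝ}
    (hf : ∀ ξ, R ≤ ‖ξ‖ → IntervalIntegrable (fun t => f t ξ) volume 0 T)
    (hg : ∀ ξ, R ≤ ‖ξ‖ → IntervalIntegrable (fun t => g t ξ) volume 0 T)
    (hfg : ∀ t ∈ Icc (0 : ℝ) T, ∀ ξ, R ≤ ‖ξ‖ → g t ξ ≤ 2 * f t ξ + M)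
    (h : ∃ C > (0 : ℝ), ∀ ξ, R ≤ ‖ξ‖ → ∫ t in (0 : ℝ)..T, f t ξ ≤ C * Real.log (1 + ‖ξ‖)) :
    ∃ C > (0 : ℝ), ∀ ξ, R ≤ ‖ξ‖ → ∫ t in (0 : ℝ)..T, g t ξ ≤ C * Real.log (1 + ‖ξ‖) := by
  obtain ⟨C, hC, hbound⟩ := h
  have hlog : 0 < Real.log (1 + R) := Real.log_pos (by linarith)
  refine ⟨2 * C + T * M / Real.log (1 + R), by positivity, fun ξ hξ => ?_⟩
  have hmono : Real.log (1 + R) ≤ Real.log (1 + ‖ξ‖) :=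
    Real.log_le_log (by linarith) (by linarith)
  have hf_two := (hf ξ hξ).const_mul 2
  calc ∫ t in (0 : ℝ)..T, g t ξ
      ≤ ∫ t in (0 : ℝ)..T, (2 * f t ξ + M) :=
        intervalIntegral.integral_mono_on hT (hg ξ hξ) (hf_two.add intervalIntegrable_const)
          fun t ht => hfg t ht ξ hξ
    _ = 2 * (∫ t in (0 : ℝ)..T, f t ξ) + T * M := by
        rw [intervalIntegral.integral_add hf_two intervalIntegrable_const,
          intervalIntegral.integral_const_mul, intervalIntegral.integral_const]
        simp
    _ ≤ 2 * (C * Real.log (1 + ‖ξ‖)) + T * M / Real.log (1 + R) * Real.log (1 + ‖ξ‖) := by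
        refine add_le_add (by linarith [hbound ξ hξ]) ?_
        calc T * M = T * M / Real.log (1 + R) * Real.log (1 + R) := by field_simp
          _ ≤ _ := by gcongr
    _ = _ := by ring

/-- An affine function with slope bounded by `K` varies by at most `2 K` over distances `≤ 2`. -/
lemma norm_add_mul_ofReal_le {b₀ b₁ : ℂ} {K x y : ℝ} (hb : ‖b₁‖ ≤ K) (hxy : |x - y| ≤ 2) :
    ‖b₀ + b₁ * (x : ℂ)‖ ≤ ‖b₀ + b₁ * (y : ℂ)‖ + 2 * K := by
  have h : b₀ + b₁ * (x : ℂ) = (b₀ + b₁ * (y : ℂ)) + b₁ * ((x - y : ℝ) : ℂ) := by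
    push_cast; ring
  rw [h]
  refine (norm_add_le _ _).trans ?_
  rw [norm_mul, Complex.norm_real, Real.norm_eq_abs]
  nlinarith [norm_nonneg b₁, abs_nonneg (x - y)]

lemma sqrt_add_eighteen_bounds {D : ℝ} (hD : 0 ≤ D) :
    √D ≤ √(D + 18) ∧ √(D + 18) ≤ √D + 9 / 2 ∧ 4 ≤ √(D + 18) := by
  refine ⟨Real.sqrt_le_sqrt (by linarith), ?_, Real.le_sqrt_of_sq_le (by linarith)⟩
  refine Real.sqrt_le_iff.2 ⟨by positivity, ?_⟩
  nlinarith [Real.sq_sqrt hD, Real.sqrt_nonneg D]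

lemma intervalIntegrable_sqrt_norm_div_add {T : ℝ} (hT : 0 ≤ T) {F G : ℝ → ℂ} {d : ℝ → ℝ}
    (hF : ContinuousOn F (Icc 0 T)) (hG : ContinuousOn G (Icc 0 T))
    (hd : ContinuousOn d (Icc 0 T)) (hd1 : ∀ t ∈ Icc 0 T, 1 ≤ d t) :
    IntervalIntegrable (fun t => √(‖F t‖ / d t) + √(‖G t‖ / d t)) volume 0 T := by
  have hd0 : ∀ t ∈ Icc 0 T, d t ≠ 0 := fun t ht => by linarith [hd1 t ht]
  refine ContinuousOn.intervalIntegrable ?_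
  rw [uIcc_of_le hT]
  exact (hF.norm.div hd hd0).sqrt.add (hG.norm.div hd hd0).sqrt

/-- Proposition on the Levi condition for the first-order terms: with
`σ1,σ2 = (-A1 ∓ √(A1²-3A2))/3` the roots of `3τ²+2A1τ+A2` and
`μ1,μ2 = (-A1 ∓ √(A1²-3A2+18))/3` the roots of `3τ²+2A1τ+A2-6`, and
`Ň(t,τ,ξ) = B0 + B1τ` with `|B1| ≤ K`, the logarithmic condition for
`√(|Ň(μ_j)|/(μ2-μ1))` is equivalent to the one for `√(|Ň(σ_j)|/(|σ2-σ1|+1))`. -/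
theorem stmt_1
    (n : ℕ) (hn : 1 ≤ n) (T R : ℝ) (hT : 0 < T) (hR : 0 < R)
    (A1 A2 : ℝ → EuclideanSpace ℝ (Fin n) → ℝ)
    (hA1 : ContinuousOn (fun p : ℝ × EuclideanSpace ℝ (Fin n) => A1 p.1 p.2)
      (Icc 0 T ×ˢ {ξ : EuclideanSpace ℝ (Fin n) | R ≤ ‖ξ‖}))
    (hA2 : ContinuousOn (fun p : ℝ × EuclideanSpace ℝ (Fin n) => A2 p.1 p.2)
      (Icc 0 T ×ˢ {ξ : EuclideanSpace ℝ (Fin n) | R ≤ ‖ξ‖}))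
    (hhyp : ∀ t ∈ Icc (0 : ℝ) T, ∀ ξ : EuclideanSpace ℝ (Fin n), R ≤ ‖ξ‖ →
      3 * A2 t ξ ≤ (A1 t ξ) ^ 2)
    (σ1 σ2 μ1 μ2 : ℝ → EuclideanSpace ℝ (Fin n) → ℝ)
    (hσ1 : ∀ t ξ, σ1 t ξ = (-(A1 t ξ) - Real.sqrt ((A1 t ξ) ^ 2 - 3 * A2 t ξ)) / 3)
    (hσ2 : ∀ t ξ, σ2 t ξ = (-(A1 t ξ) + Real.sqrt ((A1 t ξ) ^ 2 - 3 * A2 t ξ)) / 3)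
    (hμ1 : ∀ t ξ, μ1 t ξ = (-(A1 t ξ) - Real.sqrt ((A1 t ξ) ^ 2 - 3 * A2 t ξ + 18)) / 3)
    (hμ2 : ∀ t ξ, μ2 t ξ = (-(A1 t ξ) + Real.sqrt ((A1 t ξ) ^ 2 - 3 * A2 t ξ + 18)) / 3)
    (B0 B1 : ℝ → EuclideanSpace ℝ (Fin n) → ℂ)
    (hB0 : ContinuousOn (fun p : ℝ × EuclideanSpace ℝ (Fin n) => B0 p.1 p.2)
      (Icc 0 T ×ˢ {ξ : EuclideanSpace ℝ (Fin n) | R ≤ ‖ξ‖}))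
    (hB1 : ContinuousOn (fun p : ℝ × EuclideanSpace ℝ (Fin n) => B1 p.1 p.2)
      (Icc 0 T ×ˢ {ξ : EuclideanSpace ℝ (Fin n) | R ≤ ‖ξ‖}))
    (K : ℝ)
    (hK : ∀ t ∈ Icc (0 : ℝ) T, ∀ ξ : EuclideanSpace ℝ (Fin n), R ≤ ‖ξ‖ → ‖B1 t ξ‖ ≤ K)
    (Nc : ℝ → EuclideanSpace ℝ (Fin n) → ℝ → ℂ)
    (hNc : ∀ t ξ τ, Nc t ξ τ = B0 t ξ + B1 t ξ * (τ : ℂ)) :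
    (∃ C > (0 : ℝ), ∀ ξ : EuclideanSpace ℝ (Fin n), R ≤ ‖ξ‖ →
      ∫ t in (0 : ℝ)..T,
        (Real.sqrt (‖Nc t ξ (μ1 t ξ)‖ / (μ2 t ξ - μ1 t ξ))
          + Real.sqrt (‖Nc t ξ (μ2 t ξ)‖ / (μ2 t ξ - μ1 t ξ)))
        ≤ C * Real.log (1 + ‖ξ‖))
    ↔
    (∃ C > (0 : ℝ), ∀ ξ : EuclideanSpace ℝ (Fin n), R ≤ ‖ξ‖ →
      ∫ t in (0 : ℝ)..T,
        (Real.sqrt (‖Nc t ξ (σ1 t ξ)‖ / (|σ2 t ξ - σ1 t ξ| + 1))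
          + Real.sqrt (‖Nc t ξ (σ2 t ξ)‖ / (|σ2 t ξ - σ1 t ξ| + 1)))
        ≤ C * Real.log (1 + ‖ξ‖)) := by
  have hgap : ∀ t ∈ Icc (0 : ℝ) T, ∀ ξ : EuclideanSpace ℝ (Fin n), R ≤ ‖ξ‖ →
      1 ≤ μ2 t ξ - μ1 t ξ ∧ 1 ≤ |σ2 t ξ - σ1 t ξ| + 1 ∧
      |σ2 t ξ - σ1 t ξ| + 1 ≤ 3 * (μ2 t ξ - μ1 t ξ) ∧
      μ2 t ξ - μ1 t ξ ≤ 3 * (|σ2 t ξ - σ1 t ξ| + 1) ∧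
      |μ1 t ξ - σ1 t ξ| ≤ 2 ∧ |μ2 t ξ - σ2 t ξ| ≤ 2 := by
    intro t ht ξ hξ
    obtain ⟨h1, h2, h3⟩ := sqrt_add_eighteen_bounds (sub_nonneg.2 (hhyp t ht ξ hξ))
    have hσ : |σ2 t ξ - σ1 t ξ| = 2 / 3 * √((A1 t ξ) ^ 2 - 3 * A2 t ξ) := by
      rw [hσ1, hσ2, abs_of_nonneg] <;>
        linarith [Real.sqrt_nonneg ((A1 t ξ) ^ 2 - 3 * A2 t ξ)]
    have h0 := Real.sqrt_nonneg ((A1 t ξ) ^ 2 - 3 * A2 t ξ)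
    rw [hσ, hσ1, hσ2, hμ1, hμ2, abs_le, abs_le]
    refine ⟨?_, ?_, ?_, ?_, ⟨?_, ?_⟩, ?_, ?_⟩ <;> linarith
  have hsection : ∀ {Y : Type} [TopologicalSpace Y] {f : ℝ → EuclideanSpace ℝ (Fin n) → Y},
      ContinuousOn (fun p : ℝ × EuclideanSpace ℝ (Fin n) => f p.1 p.2)
        (Icc 0 T ×ˢ {ξ : EuclideanSpace ℝ (Fin n) | R ≤ ‖ξ‖}) →
      ∀ ξ, R ≤ ‖ξ‖ → ContinuousOn (fun t => f t ξ) (Icc 0 T) := fun hf ξ hξ =>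
    hf.comp (f := fun t => (t, ξ)) (by fun_prop) fun t ht => ⟨ht, hξ⟩
  have hroots : ∀ ξ, R ≤ ‖ξ‖ →
      ContinuousOn (fun t => σ1 t ξ) (Icc 0 T) ∧ ContinuousOn (fun t => σ2 t ξ) (Icc 0 T) ∧
      ContinuousOn (fun t => μ1 t ξ) (Icc 0 T) ∧ ContinuousOn (fun t => μ2 t ξ) (Icc 0 T) := by
    intro ξ hξ
    have := hsection hA1 ξ hξ
    have := hsection hA2 ξ hξ
    simp only [hσ1, hσ2, hμ1, hμ2]
    refine ⟨?_, ?_, ?_, ?_⟩ <;> fun_prop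
  have hN : ∀ ξ, R ≤ ‖ξ‖ → ∀ {r : ℝ → ℝ}, ContinuousOn r (Icc 0 T) →
      ContinuousOn (fun t => Nc t ξ (r t)) (Icc 0 T) := by
    intro ξ hξ r hr
    simp only [hNc]
    exact (hsection hB0 ξ hξ).add
      ((hsection hB1 ξ hξ).mul (Complex.continuous_ofReal.comp_continuousOn hr))
  have hμ_int : ∀ ξ, R ≤ ‖ξ‖ → IntervalIntegrable (fun t =>
      √(‖Nc t ξ (μ1 t ξ)‖ / (μ2 t ξ - μ1 t ξ)) + √(‖Nc t ξ (μ2 t ξ)‖ / (μ2 t ξ - μ1 t ξ)))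
      volume 0 T := by
    intro ξ hξ
    obtain ⟨-, -, hm1, hm2⟩ := hroots ξ hξ
    exact intervalIntegrable_sqrt_norm_div_add hT.le (hN ξ hξ hm1) (hN ξ hξ hm2) (hm2.sub hm1)
      fun t ht => (hgap t ht ξ hξ).1
  have hσ_int : ∀ ξ, R ≤ ‖ξ‖ → IntervalIntegrable (fun t =>
      √(‖Nc t ξ (σ1 t ξ)‖ / (|σ2 t ξ - σ1 t ξ| + 1))
        + √(‖Nc t ξ (σ2 t ξ)‖ / (|σ2 t ξ - σ1 t ξ| + 1)))
      volume 0 T := by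
    intro ξ hξ
    obtain ⟨hs1, hs2, -, -⟩ := hroots ξ hξ
    exact intervalIntegrable_sqrt_norm_div_add hT.le (hN ξ hξ hs1) (hN ξ hξ hs2)
      ((hs2.sub hs1).abs.add continuousOn_const) fun t ht => (hgap t ht ξ hξ).2.1
  have hNle : ∀ t ∈ Icc (0 : ℝ) T, ∀ ξ : EuclideanSpace ℝ (Fin n), R ≤ ‖ξ‖ → ∀ {x y : ℝ},
      |x - y| ≤ 2 → ‖Nc t ξ x‖ ≤ ‖Nc t ξ y‖ + 2 * |K| := by
    intro t ht ξ hξ x y hxy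
    rw [hNc, hNc]
    exact norm_add_mul_ofReal_le ((hK t ht ξ hξ).trans (le_abs_self K)) hxy
  have hL : 0 ≤ 2 * |K| := by positivity
  have hM : 0 ≤ √(2 * |K|) + √(2 * |K|) := by positivity
  constructor
  · refine exists_integral_le_mul_log_of_le hT.le hR hM hμ_int hσ_int fun t ht ξ hξ => ?_
    obtain ⟨hp, hq, hqp, hpq, h1, h2⟩ := hgap t ht ξ hξ
    rw [abs_sub_comm] at h1 h2
    linarith [sqrt_div_le_two_mul_sqrt_div_add (norm_nonneg _) hL hq hp hpq (hNle t ht ξ hξ h1),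
      sqrt_div_le_two_mul_sqrt_div_add (norm_nonneg _) hL hq hp hpq (hNle t ht ξ hξ h2)]
  · refine exists_integral_le_mul_log_of_le hT.le hR hM hσ_int hμ_int fun t ht ξ hξ => ?_
    obtain ⟨hp, hq, hqp, hpq, h1, h2⟩ := hgap t ht ξ hξ
    linarith [sqrt_div_le_two_mul_sqrt_div_add (norm_nonneg _) hL hp hq hqp (hNle t ht ξ hξ h1),
      sqrt_div_le_two_mul_sqrt_div_add (norm_nonneg _) hL hp hq hqp (hNle t ht ξ hξ h2)]
end

section
/- There exist constants C₁>0 and C₂>0 such that for every monic cubic polynomial p(τ)=τ³+A1τ²+A2τ+A3 with real coefficients having three real roots τ1≤τ2≤τ3, and for every h>0, the polynomial q(τ)=p(τ)−h²·p''(τ) has three real, pairwise distinct roots λ1<λ2<λ3 which satisfy |λ_j−τ_j|≤C₁·h for j=1,2,3 and λ_{j+1}−λ_j≥C₂·h for j=1,2. -/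
/-- A monic cubic with roots `a`, `b`, `c`, minus `h²` times its second derivative. -/
def cubicPerturb (a b c h t : ℝ) : ℝ :=
  (t - a) * (t - b) * (t - c) - 2 * h ^ 2 * ((t - a) + (t - b) + (t - c))

lemma cubicPerturb_neg (a b c h t : ℝ) :
    cubicPerturb (-c) (-b) (-a) h (-t) = -cubicPerturb a b c h t := by
  unfold cubicPerturb
  ring

lemma continuous_cubicPerturb (a b c h : ℝ) : Continuous (cubicPerturb a b c h) := by
  unfold cubicPerturb
  fun_prop

lemma cubicPerturb_max_nonpos {a b c : ℝ} (h : ℝ) (hab : a ≤ b) (hbc : b ≤ c) :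
    cubicPerturb a b c h c ≤ 0 := by
  unfold cubicPerturb
  have : 0 ≤ h ^ 2 * ((c - a) + (c - b)) := mul_nonneg (sq_nonneg h) (by linarith)
  linarith

lemma cubicPerturb_max_add_pos {a b c h : ℝ} (hab : a ≤ b) (hbc : b ≤ c) (hh : 0 < h) :
    0 < cubicPerturb a b c h (c + 3 * h) := by
  obtain ⟨u, hu, rfl⟩ : ∃ u, 0 ≤ u ∧ b = c - u := ⟨c - b, by linarith, by ring⟩
  obtain ⟨v, hv, rfl⟩ : ∃ v, 0 ≤ v ∧ a = c - u - v := ⟨c - u - a, by linarith, by ring⟩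
  have e : cubicPerturb (c - u - v) (c - u) c h (c + 3 * h)
      = 9 * h ^ 3 + 14 * h ^ 2 * u + 7 * h ^ 2 * v + 3 * h * u ^ 2 + 3 * h * u * v := by
    unfold cubicPerturb
    ring
  rw [e]
  positivity

lemma cubicPerturb_mid_add_nonpos {a b c h : ℝ} (hab : a ≤ b) (hh : 0 < h)
    (hc : b + 2 * h ≤ c) : cubicPerturb a b c h (b + 2 * h) ≤ 0 := by
  obtain ⟨u, hu, rfl⟩ : ∃ u, 0 ≤ u ∧ c = b + 2 * h + u := ⟨c - (b + 2 * h), by linarith, by ring⟩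
  obtain ⟨v, hv, rfl⟩ : ∃ v, 0 ≤ v ∧ a = b - v := ⟨b - a, by linarith, by ring⟩
  have e : cubicPerturb (b - v) b (b + 2 * h + u) h (b + 2 * h)
      = -(2 * h ^ 2 * u + 2 * h * u * v + 8 * h ^ 3 + 2 * h ^ 2 * v) := by
    unfold cubicPerturb
    ring
  rw [e, neg_nonpos]
  positivity

lemma cubicPerturb_min_nonpos {a b c h : ℝ} (hab : a ≤ b) (hbc : b ≤ c) (hh : 0 < h) :
    cubicPerturb a b c h (min (b + 2 * h) c) ≤ 0 := by
  rcases le_total (b + 2 * h) c with hc | hc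
  · rw [min_eq_left hc]
    exact cubicPerturb_mid_add_nonpos hab hh hc
  · rw [min_eq_right hc]
    exact cubicPerturb_max_nonpos h hab hbc

lemma exists_cubicPerturb_root_max {a b c h : ℝ} (hab : a ≤ b) (hbc : b ≤ c) (hh : 0 < h) :
    ∃ t, c ≤ t ∧ t ≤ c + 3 * h ∧ cubicPerturb a b c h t = 0 := by
  obtain ⟨t, ht, h0⟩ := intermediate_value_Icc (by linarith : c ≤ c + 3 * h)
    (continuous_cubicPerturb a b c h).continuousOn
    ⟨cubicPerturb_max_nonpos h hab hbc, (cubicPerturb_max_add_pos hab hbc hh).le⟩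
  exact ⟨t, ht.1, ht.2, h0⟩

lemma exists_cubicPerturb_root_min {a b c h : ℝ} (hab : a ≤ b) (hbc : b ≤ c) (hh : 0 < h) :
    ∃ t, a - 3 * h ≤ t ∧ t ≤ a ∧ cubicPerturb a b c h t = 0 := by
  obtain ⟨t, h1, h2, h0⟩ := exists_cubicPerturb_root_max (neg_le_neg hbc) (neg_le_neg hab) hh
  refine ⟨-t, by linarith, by linarith, ?_⟩
  have := cubicPerturb_neg a b c h (-t)
  rw [neg_neg, h0] at this
  linarith

lemma exists_cubicPerturb_root_mid {a b c h : ℝ} (hab : a ≤ b) (hbc : b ≤ c) (hh : 0 < h) :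
    ∃ t, a ≤ t ∧ t ≤ c ∧ |t - b| ≤ 2 * h ∧ cubicPerturb a b c h t = 0 := by
  have hr := cubicPerturb_min_nonpos hab hbc hh
  have hl := cubicPerturb_min_nonpos (neg_le_neg hbc) (neg_le_neg hab) hh
  have e : min (-b + 2 * h) (-a) = -max (b - 2 * h) a := by
    rw [← min_neg_neg]
    congr 1
    ring
  rw [e, cubicPerturb_neg] at hl
  obtain ⟨t, ⟨h1, h2⟩, h0⟩ := intermediate_value_Icc'
    (max_le (le_min (by linarith) (by linarith)) (le_min (by linarith) (by linarith)) :
      max (b - 2 * h) a ≤ min (b + 2 * h) c)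
    (continuous_cubicPerturb a b c h).continuousOn ⟨hr, by linarith⟩
  rw [max_le_iff] at h1
  rw [le_min_iff] at h2
  exact ⟨t, h1.2, h2.2, abs_le.2 ⟨by linarith, by linarith⟩, h0⟩

lemma cubicPerturb_root_gap {a b c h s t : ℝ} (hab : a ≤ b) (hbc : b ≤ c) (hac : a < c)
    (hh : 0 < h) (hsc : s ≤ c) (hct : c ≤ t)
    (hs : cubicPerturb a b c h s = 0) (ht : cubicPerturb a b c h t = 0) : h ≤ t - s := by
  by_contra! hlt
  unfold cubicPerturb at hs ht
  have hbt : 2 * h ^ 2 ≤ (t - b) * (t - c) := by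
    have : 0 ≤ (t - a) * ((t - b) * (t - c) - 2 * h ^ 2) := by
      have : 0 ≤ 2 * h ^ 2 * ((t - b) + (t - c)) := mul_nonneg (by positivity) (by linarith)
      linarith
    linarith [nonneg_of_mul_nonneg_right this (by linarith)]
  have hb : 2 * h < t - b := by
    by_contra! hle
    nlinarith [mul_le_mul_of_nonneg_right hle (by linarith : 0 ≤ t - c)]
  have hprod : 0 ≤ (s - a) * (s - b) * (c - s) :=
    mul_nonneg (mul_nonneg (by linarith) (by linarith)) (by linarith)
  have hsum : 0 < h ^ 2 * ((s - a) + (s - b) + (s - c)) := mul_pos (by positivity) (by linarith)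
  linarith

lemma cubic_eq_prod_of_roots {A B C x y z : ℝ} (hxy : x < y) (hyz : y < z)
    (hx : x ^ 3 + A * x ^ 2 + B * x + C = 0) (hy : y ^ 3 + A * y ^ 2 + B * y + C = 0)
    (hz : z ^ 3 + A * z ^ 2 + B * z + C = 0) (t : ℝ) :
    t ^ 3 + A * t ^ 2 + B * t + C = (t - x) * (t - y) * (t - z) := by
  have h1 : x ^ 2 + x * y + y ^ 2 + A * (x + y) + B = 0 :=
    mul_left_cancel₀ (sub_pos.2 hxy).ne' (by linear_combination hy - hx)
  have h2 : y ^ 2 + y * z + z ^ 2 + A * (y + z) + B = 0 :=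
    mul_left_cancel₀ (sub_pos.2 hyz).ne' (by linear_combination hz - hy)
  have hA : x + y + z + A = 0 :=
    mul_left_cancel₀ (sub_pos.2 (hxy.trans hyz)).ne' (by linear_combination h2 - h1)
  obtain rfl : A = -(x + y + z) := by linarith
  obtain rfl : B = x * y + y * z + x * z := by linarith
  obtain rfl : C = -(x * y * z) := by linarith
  ring

/-- Three separated roots of `cubicPerturb a b c h`, each close to the corresponding root of
`(t - a) (t - b) (t - c)`. -/
lemma exists_separated_cubicPerturb_roots {a b c h : ℝ} (hab : a ≤ b) (hbc : b ≤ c) (hh : 0 < h) :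
    ∃ x y z, cubicPerturb a b c h x = 0 ∧ cubicPerturb a b c h y = 0 ∧
      cubicPerturb a b c h z = 0 ∧ |x - a| ≤ 3 * h ∧ |y - b| ≤ 3 * h ∧ |z - c| ≤ 3 * h ∧
      h ≤ y - x ∧ h ≤ z - y := by
  rcases (hab.trans hbc).lt_or_eq with hac | rfl
  · obtain ⟨x, hx1, hx2, hx⟩ := exists_cubicPerturb_root_min hab hbc hh
    obtain ⟨y, hy1, hy2, hyb, hy⟩ := exists_cubicPerturb_root_mid hab hbc hh
    obtain ⟨z, hz1, hz2, hz⟩ := exists_cubicPerturb_root_max hab hbc hh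
    refine ⟨x, y, z, hx, hy, hz, abs_le.2 ⟨by linarith, by linarith⟩, by linarith,
      abs_le.2 ⟨by linarith, by linarith⟩, ?_, cubicPerturb_root_gap hab hbc hac hh hy2 hz1 hy hz⟩
    have := cubicPerturb_root_gap (neg_le_neg hbc) (neg_le_neg hab) (neg_lt_neg hac) hh
      (neg_le_neg hy1) (neg_le_neg hx2) (by rw [cubicPerturb_neg, hy, neg_zero])
      (by rw [cubicPerturb_neg, hx, neg_zero])
    linarith
  · obtain rfl := le_antisymm hab hbc
    have hsq : √6 ^ 2 = 6 := Real.sq_sqrt (by norm_num)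
    have h1 : 1 ≤ √6 := Real.one_le_sqrt.2 (by norm_num)
    have h3 : √6 ≤ 3 := Real.sqrt_le_iff.2 (by norm_num)
    have hlo : h ≤ √6 * h := le_mul_of_one_le_left hh.le h1
    have hhi : √6 * h ≤ 3 * h := mul_le_mul_of_nonneg_right h3 hh.le
    refine ⟨a - √6 * h, a, a + √6 * h, ?_, ?_, ?_, abs_le.2 ⟨by linarith, by linarith⟩,
      abs_le.2 ⟨by linarith, by linarith⟩, abs_le.2 ⟨by linarith, by linarith⟩,
      by linarith, by linarith⟩
    all_goals unfold cubicPerturb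
    · linear_combination -(√6 * h ^ 3) * hsq
    · ring
    · linear_combination (√6 * h ^ 3) * hsq

/-- Jannelli's lemma: there are universal constants `C₁, C₂ > 0` such that for every
real-rooted monic cubic `p(τ) = τ³+A1τ²+A2τ+A3 = (τ-τ1)(τ-τ2)(τ-τ3)` with `τ1 ≤ τ2 ≤ τ3`
and every `h > 0`, the polynomial `q(τ) = p(τ) - h² p''(τ)` has three real pairwise distinct
roots `λ1 < λ2 < λ3` with `|λ_j - τ_j| ≤ C₁ h` and `λ_{j+1} - λ_j ≥ C₂ h`. -/
theorem stmt_2 :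
    ∃ C₁ > (0 : ℝ), ∃ C₂ > (0 : ℝ),
      ∀ A1 A2 A3 τ1 τ2 τ3 : ℝ,
        (∀ τ : ℝ, τ ^ 3 + A1 * τ ^ 2 + A2 * τ + A3 = (τ - τ1) * (τ - τ2) * (τ - τ3)) →
        τ1 ≤ τ2 → τ2 ≤ τ3 →
        ∀ h : ℝ, 0 < h →
          ∃ l1 l2 l3 : ℝ,
            (∀ τ : ℝ, τ ^ 3 + A1 * τ ^ 2 + A2 * τ + A3 - h ^ 2 * (6 * τ + 2 * A1)
              = (τ - l1) * (τ - l2) * (τ - l3)) ∧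
            l1 < l2 ∧ l2 < l3 ∧
            |l1 - τ1| ≤ C₁ * h ∧ |l2 - τ2| ≤ C₁ * h ∧ |l3 - τ3| ≤ C₁ * h ∧
            C₂ * h ≤ l2 - l1 ∧ C₂ * h ≤ l3 - l2 := by
  refine ⟨3, by norm_num, 1, one_pos, ?_⟩
  intro A1 A2 A3 a b c hp hab hbc h hh
  obtain ⟨x, y, z, hx, hy, hz, hxa, hyb, hzc, hxy, hyz⟩ :=
    exists_separated_cubicPerturb_roots hab hbc hh
  have hA1 : A1 = -(a + b + c) := by linarith [hp 0, hp 1, hp (-1)]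
  have hq (t : ℝ) : t ^ 3 + A1 * t ^ 2 + (A2 - 6 * h ^ 2) * t + (A3 - 2 * h ^ 2 * A1)
      = cubicPerturb a b c h t := by
    unfold cubicPerturb
    linear_combination hp t - 2 * h ^ 2 * hA1
  have hlt1 : x < y := by linarith
  have hlt2 : y < z := by linarith
  refine ⟨x, y, z, fun t => ?_, hlt1, hlt2, hxa, hyb, hzc, by linarith, by linarith⟩
  rw [← cubic_eq_prod_of_roots hlt1 hlt2 ((hq x).trans hx) ((hq y).trans hy) ((hq z).trans hz) t]
  ring
end

section
/- Let O⊆ℂ be an open connected set and let f₁,…,f_d be analytic functions on O, with f_j not identically zero for each j=1,…,d. For α=(α₁,…,α_d)∈ℝ^d set φ_α(x)=Σ_{j=1}^d α_j·f_j(x). Then for every compact set K⊆O there exists ν∈ℕ such that for every α∈ℝ^d, either φ_α is identically zero on O, or φ_α has at most ν zeros in K counted with multiplicity (i.e. the sum over the zeros z∈K of φ_α of the vanishing order of φ_α at z is at most ν). -/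
/-- The vanishing order of `f` at `z`: the order of the first nonvanishing term of the
power series expansion of `f` at `z`, i.e. the least `m` with `f⁽ᵐ⁾(z) ≠ 0`. -/
noncomputable def vanishingOrder (f : ℂ → ℂ) (z : ℂ) : ℕ :=
  sInf {m : ℕ | iteratedDeriv m f z ≠ 0}

/-- Dividing out one zero `a` in the small ball at a time and applying the maximum modulus
principle on the ball of radius `5 * r` gains a factor `1 / 2` per zero. -/
lemma norm_le_div_two_pow_of_le_sum_analyticOrderAt {O : Set ℂ} (hO : IsOpen O) {c : ℂ} {r : ℝ}
    (hr : 0 < r) (hball : Metric.closedBall c (5 * r) ⊆ O) (S : Finset ℂ)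
    (hS : ↑S ⊆ Metric.closedBall c r) (n : ℕ) {g : ℂ → ℂ} {M : ℝ} (hg : DifferentiableOn ℂ g O)
    (hn : (n : ℕ∞) ≤ ∑ z ∈ S, analyticOrderAt g z)
    (hM : ∀ z ∈ Metric.closedBall c (5 * r), ‖g z‖ ≤ M) :
    ∀ z ∈ Metric.closedBall c r, ‖g z‖ ≤ M / 2 ^ n := by
  have hsub : Metric.closedBall c r ⊆ Metric.closedBall c (5 * r) :=
    Metric.closedBall_subset_closedBall (by linarith)
  induction n generalizing g M with
  | zero => intro z hz; simpa using hM z (hsub hz)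
  | succ n ih =>
    obtain ⟨a, haS, ha⟩ : ∃ a ∈ S, analyticOrderAt g a ≠ 0 := by
      by_contra! h
      rw [Finset.sum_eq_zero h] at hn
      simp at hn
    have hac : a ∈ Metric.closedBall c r := hS haS
    have haO : a ∈ O := hball (hsub hac)
    have hga : g a = 0 := apply_eq_zero_of_analyticOrderAt_ne_zero ha
    set h := dslope g a with hh
    have hdiff : DifferentiableOn ℂ h O :=
      (Complex.differentiableOn_dslope (hO.mem_nhds haO)).2 hg
    have hfac : g = (fun z => z - a) * h := by
      funext z
      have := sub_smul_dslope g a z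
      simp only [hga, sub_zero, smul_eq_mul] at this
      simp [hh, this]
    have hord : ∀ z ∈ S, analyticOrderAt g z
        = analyticOrderAt (fun z => z - a) z + analyticOrderAt h z := by
      intro z hz
      conv_lhs => rw [hfac]
      exact analyticOrderAt_mul (by fun_prop)
        (hdiff.analyticAt (hO.mem_nhds (hball (hsub (hS hz)))))
    have hsum : ∑ z ∈ S, analyticOrderAt (fun z => z - a) z = 1 := by
      rw [Finset.sum_eq_single_of_mem a haS]
      · exact analyticOrderAt_id_sub_const_self
      · intro z _ hza
        exact analyticOrderAt_id_sub_const_of_ne hza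
    rw [Finset.sum_congr rfl hord, Finset.sum_add_distrib, hsum, Nat.cast_add, Nat.cast_one,
      add_comm, ENat.add_le_add_iff_left (by simp)] at hn
    have hbound : ∀ z ∈ Metric.closedBall c (5 * r), ‖h z‖ ≤ M / (4 * r) := by
      intro z hz
      have hcl : closure (Metric.ball c (5 * r)) = Metric.closedBall c (5 * r) :=
        closure_ball c (by positivity)
      refine Complex.norm_le_of_forall_mem_frontier_norm_le (U := Metric.ball c (5 * r))
        Metric.isBounded_ball ?_ ?_ (hcl ▸ hz)
      · exact DifferentiableOn.diffContOnCl (hcl ▸ hdiff.mono hball)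
      · intro w hw
        rw [frontier_ball c (by positivity)] at hw
        have hMw := hM w (Metric.sphere_subset_closedBall hw)
        rw [hfac] at hMw
        simp only [Pi.mul_apply, norm_mul] at hMw
        have hwa : 4 * r ≤ ‖w - a‖ := by
          have h1 := dist_triangle w a c
          rw [Metric.mem_sphere] at hw
          rw [Metric.mem_closedBall] at hac
          rw [← dist_eq_norm]
          linarith
        rw [le_div_iff₀ (by positivity)]
        nlinarith [norm_nonneg (h w)]
    intro z hz
    have hz' := ih hdiff hn hbound z hz
    have hza : ‖z - a‖ ≤ 2 * r := by
      have h1 := dist_triangle_right z a c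
      rw [Metric.mem_closedBall] at hac hz
      rw [← dist_eq_norm]
      linarith
    rw [hfac, Pi.mul_apply, norm_mul]
    calc ‖z - a‖ * ‖h z‖ ≤ 2 * r * (M / (4 * r) / 2 ^ n) := by gcongr
      _ = M / 2 ^ (n + 1) := by field_simp; ring

lemma vanishingOrder_le_analyticOrderAt {f : ℂ → ℂ} {z : ℂ} (hf : AnalyticAt ℂ f z) :
    (vanishingOrder f z : ℕ∞) ≤ analyticOrderAt f z := by
  rw [natCast_le_analyticOrderAt_iff_iteratedDeriv_eq_zero hf]
  intro i hi
  by_contra h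
  exact Nat.notMem_of_lt_sInf hi h

/-- Two linear maps from a finite-dimensional space satisfying `ker L₁ ≤ ker L₂` are comparable
in norm. -/
lemma LinearMap.exists_norm_le_mul_norm_of_ker_le {V E F : Type*} [AddCommGroup V] [Module ℝ V]
    [FiniteDimensional ℝ V] [NormedAddCommGroup E] [NormedSpace ℝ E] [NormedAddCommGroup F]
    [NormedSpace ℝ F] (L₁ : V →ₗ[ℝ] E) (L₂ : V →ₗ[ℝ] F)
    (hker : LinearMap.ker L₁ ≤ LinearMap.ker L₂) :
    ∃ C : ℝ, ∀ v, ‖L₂ v‖ ≤ C * ‖L₁ v‖ := by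
  obtain ⟨s, hs⟩ := L₁.rangeRestrict.exists_rightInverse_of_surjective L₁.range_rangeRestrict
  let T := (L₂ ∘ₗ s).toContinuousLinearMap
  refine ⟨‖T‖, fun v => ?_⟩
  have hv : L₁.rangeRestrict (s (L₁.rangeRestrict v)) = L₁.rangeRestrict v :=
    LinearMap.congr_fun hs _
  have hmem : v - s (L₁.rangeRestrict v) ∈ LinearMap.ker L₁ := by
    have : L₁ (s (L₁.rangeRestrict v)) = L₁ v := congrArg Subtype.val hv
    rw [LinearMap.mem_ker, map_sub, this, sub_self]
  have hT : L₂ v = T (L₁.rangeRestrict v) := by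
    have := hker hmem
    rwa [LinearMap.mem_ker, map_sub, sub_eq_zero] at this
  rw [hT]
  exact T.le_opNorm _

/-- The real linear map sending `α` to the restriction of `∑ j, α j * f j` to `s`. -/
noncomputable def restrictCombination {d : ℕ} {f : Fin d → ℂ → ℂ} (s : Set ℂ)
    (hf : ∀ j, ContinuousOn (f j) s) : (Fin d → ℝ) →ₗ[ℝ] C(s, ℂ) :=
  Fintype.linearCombination ℝ fun j => ⟨s.domRestrict (f j), (hf j).domRestrict⟩

lemma restrictCombination_apply {d : ℕ} {f : Fin d → ℂ → ℂ} {s : Set ℂ}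
    (hf : ∀ j, ContinuousOn (f j) s) (α : Fin d → ℝ) (x : s) :
    restrictCombination s hf α x = ∑ j, (α j : ℂ) * f j x := by
  simp [restrictCombination, Fintype.linearCombination_apply]

lemma exists_sum_vanishingOrder_le_on_closedBall {O : Set ℂ} (hO : IsOpen O)
    (hOconn : IsPreconnected O) {d : ℕ} {f : Fin d → ℂ → ℂ}
    (hf : ∀ j, DifferentiableOn ℂ (f j) O) {c : ℂ} {r : ℝ} (hr : 0 < r)
    (hball : Metric.closedBall c (5 * r) ⊆ O) :
    ∃ ν : ℕ, ∀ α : Fin d → ℝ,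
      (∀ x ∈ O, ∑ j, (α j : ℂ) * f j x = 0) ∨
      (∀ S : Finset ℂ, ↑S ⊆ Metric.closedBall c r →
        ∑ z ∈ S, vanishingOrder (fun x => ∑ j, (α j : ℂ) * f j x) z ≤ ν) := by
  have hsub : Metric.closedBall c r ⊆ Metric.closedBall c (5 * r) :=
    Metric.closedBall_subset_closedBall (by linarith)
  have hφ : ∀ α : Fin d → ℝ, DifferentiableOn ℂ (fun x => ∑ j, (α j : ℂ) * f j x) O :=
    fun α => DifferentiableOn.fun_sum fun j _ => (hf j).const_mul _
  have hcont : ∀ j, ContinuousOn (f j) (Metric.closedBall c (5 * r)) :=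
    fun j => (hf j).continuousOn.mono hball
  have := isCompact_iff_compactSpace.1 (isCompact_closedBall c r)
  have := isCompact_iff_compactSpace.1 (isCompact_closedBall c (5 * r))
  let L₁ := restrictCombination (Metric.closedBall c r) fun j => (hcont j).mono hsub
  let L₂ := restrictCombination (Metric.closedBall c (5 * r)) hcont
  have hzero : ∀ α, L₁ α = 0 → ∀ x ∈ O, ∑ j, (α j : ℂ) * f j x = 0 := by
    intro α hα
    refine ((hφ α).analyticOnNhd hO).eqOn_zero_of_preconnected_of_eventuallyEq_zero hOconn
      (hball (Metric.mem_closedBall_self (by positivity))) ?_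
    filter_upwards [Metric.closedBall_mem_nhds c hr] with x hx
    have := restrictCombination_apply (fun j => (hcont j).mono hsub) α ⟨x, hx⟩
    rw [← this]
    exact DFunLike.congr_fun hα _
  obtain ⟨C, hC⟩ := L₁.exists_norm_le_mul_norm_of_ker_le L₂ (by
    intro α hα
    refine LinearMap.mem_ker.2 (ContinuousMap.ext fun x => ?_)
    rw [restrictCombination_apply]
    exact hzero α hα x (hball x.2))
  obtain ⟨N, hN⟩ := pow_unbounded_of_one_lt C (one_lt_two (α := ℝ))
  refine ⟨N, fun α => ?_⟩
  by_cases hα : L₁ α = 0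
  · exact .inl (hzero α hα)
  refine .inr fun S hS => ?_
  by_contra! hlt
  have hle : (N : ℕ∞) ≤ ∑ z ∈ S, analyticOrderAt (fun x => ∑ j, (α j : ℂ) * f j x) z := by
    refine (Nat.cast_le.2 hlt.le).trans ?_
    rw [Nat.cast_sum]
    exact Finset.sum_le_sum fun z hz => vanishingOrder_le_analyticOrderAt
      ((hφ α).analyticAt (hO.mem_nhds (hball (hsub (hS hz)))))
  have hsmall := norm_le_div_two_pow_of_le_sum_analyticOrderAt hO hr hball S hS N (hφ α) hle
    (M := C * ‖L₁ α‖) fun z hz => by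
      rw [← restrictCombination_apply hcont α ⟨z, hz⟩]
      exact ((L₂ α).norm_coe_le_norm _).trans (hC α)
  have hpos : 0 < ‖L₁ α‖ := norm_pos_iff.2 hα
  have : Nonempty (Metric.closedBall c r) := ⟨⟨c, Metric.mem_closedBall_self hr.le⟩⟩
  have hnorm : ‖L₁ α‖ ≤ C * ‖L₁ α‖ / 2 ^ N := by
    refine (ContinuousMap.norm_le_of_nonempty _).2 fun x => ?_
    rw [restrictCombination_apply]
    exact hsmall x x.2
  rw [le_div_iff₀ (by positivity)] at hnorm
  nlinarith

/-- If `f₁, …, f_d` are analytic on an open connected set `O ⊆ ℂ`, none identically zero,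
then for every compact `K ⊆ O` there is `ν` such that for every `α ∈ ℝ^d` the combination
`φ_α = Σ α_j f_j` is either identically zero on `O` or has at most `ν` zeros in `K`
counted with multiplicity. -/
theorem stmt_3 (O : Set ℂ) (hO : IsOpen O) (hOconn : IsConnected O)
    (d : ℕ) (f : Fin d → ℂ → ℂ)
    (hf : ∀ j, DifferentiableOn ℂ (f j) O)
    (hfne : ∀ j, ∃ x ∈ O, f j x ≠ 0)
    (K : Set ℂ) (hK : IsCompact K) (hKO : K ⊆ O) :
    ∃ ν : ℕ, ∀ α : Fin d → ℝ,
      (∀ x ∈ O, ∑ j, (α j : ℂ) * f j x = 0) ∨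
      (∀ S : Finset ℂ, ↑S ⊆ K →
        (∀ z ∈ S, ∑ j, (α j : ℂ) * f j z = 0) →
        ∑ z ∈ S, vanishingOrder (fun x => ∑ j, (α j : ℂ) * f j x) z ≤ ν) := by
  have hlocal : ∃ ν : ℕ, ∀ α : Fin d → ℝ,
      (∀ x ∈ O, ∑ j, (α j : ℂ) * f j x = 0) ∨
      (∀ S : Finset ℂ, ↑S ⊆ K →
        ∑ z ∈ S, vanishingOrder (fun x => ∑ j, (α j : ℂ) * f j x) z ≤ ν) := by
    refine hK.induction_on (p := fun A => ∃ ν : ℕ, ∀ α : Fin d → ℝ,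
      (∀ x ∈ O, ∑ j, (α j : ℂ) * f j x = 0) ∨
      (∀ S : Finset ℂ, ↑S ⊆ A →
        ∑ z ∈ S, vanishingOrder (fun x => ∑ j, (α j : ℂ) * f j x) z ≤ ν)) ?_ ?_ ?_ ?_
    · refine ⟨0, fun α => .inr fun S hS => ?_⟩
      rw [Set.subset_empty_iff, Finset.coe_eq_empty] at hS
      simp [hS]
    · rintro A B hAB ⟨ν, hν⟩
      exact ⟨ν, fun α => (hν α).imp_right fun h S hS => h S (hS.trans hAB)⟩
    · rintro A B ⟨ν, hν⟩ ⟨μ, hμ⟩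
      refine ⟨ν + μ, fun α => ?_⟩
      rcases hν α with h | hA
      · exact .inl h
      rcases hμ α with h | hB
      · exact .inl h
      refine .inr fun S hS => ?_
      classical
      rw [← Finset.sum_filter_add_sum_filter_not S (· ∈ A)]
      refine add_le_add (hA _ fun z hz => ?_) (hB _ fun z hz => ?_)
      · exact (Finset.mem_filter.1 hz).2
      · exact (hS (Finset.mem_filter.1 hz).1).resolve_left (Finset.mem_filter.1 hz).2
    · intro x hx
      obtain ⟨ε, hε, hεO⟩ := Metric.nhds_basis_closedBall.mem_iff.1 (hO.mem_nhds (hKO hx))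
      refine ⟨Metric.closedBall x (ε / 5),
        mem_nhdsWithin_of_mem_nhds (Metric.closedBall_mem_nhds x (by positivity)), ?_⟩
      exact exists_sum_vanishingOrder_le_on_closedBall hO hOconn.isPreconnected hf
        (by positivity) (by rwa [mul_div_cancel₀ ε (by norm_num)])
  obtain ⟨ν, hν⟩ := hlocal
  exact ⟨ν, fun α => (hν α).imp_right fun h S hS _ => h S hS⟩
end

section
/- Let T>0, R>0, n≥1, Ξ={ξ∈ℝⁿ : |ξ|≥R}, and let f:[0,T]×Ξ→ℝ satisfy: (1) f is Lipschitz continuous in t uniformly in ξ, i.e. there exists C₀>0 with |f(t₁,ξ)−f(t₂,ξ)|≤C₀|t₁−t₂| for all t₁,t₂∈[0,T] and ξ∈Ξ; (2) there exist constants A,C₁,C₂>0 such that C₁(1+|ξ|)^{−A}≤f(t,ξ)≤C₂(1+|ξ|)^{A} for all t∈[0,T], ξ∈Ξ; (3) there exists ν∈ℕ such that for every ξ∈Ξ there is a partition 0=t₁<t₂<…<t_{μ−1}<t_μ=T of [0,T] with μ≤ν such that f(·,ξ) is continuously differentiable on each open subinterval (t_j,t_{j+1}) and ∂_t f(t,ξ)≠0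 for every t∈(t_j,t_{j+1}), j=1,…,μ−1. Then there exists a constant C>0, depending only on A,C₀,C₁,C₂,ν,T,R, such that ∫₀ᵀ |∂_t f(t,ξ)|/f(t,ξ) dt ≤ C·log(1+|ξ|) for every ξ∈Ξ. -/
open Set

/-- If `g` is continuous on `[a, b]`, takes values in `[m, M]` with `0 < m`, and `g'` does not vanish
on `(a, b)`, then the total variation of `log g` is integrable and at most `log M - log m`. -/
theorem integral_abs_deriv_div_le_log_sub_log {g : ℝ → ℝ} {a b m M : ℝ} (hab : a ≤ b) (hm : 0 < m)
    (hg : ContinuousOn g (Icc a b)) (hbd : ∀ t ∈ Icc a b, m ≤ g t ∧ g t ≤ M)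
    (hd : ∀ t ∈ Ioo a b, deriv g t ≠ 0) :
    IntervalIntegrable (fun t => |deriv g t| / g t) MeasureTheory.volume a b ∧
      ∫ t in a..b, |deriv g t| / g t ≤ Real.log M - Real.log m := by
  have hpos : ∀ t ∈ Icc a b, 0 < g t := fun t ht => hm.trans_le (hbd t ht).1
  have hder : ∀ t ∈ Ioo a b, HasDerivAt g (deriv g t) t := fun t ht =>
    (differentiableAt_of_deriv_ne_zero (hd t ht)).hasDerivAt
  have hlog : ContinuousOn (fun t => Real.log (g t)) (Icc a b) :=
    hg.log fun t ht => (hpos t ht).ne'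
  have hderlog : ∀ t ∈ Ioo a b, HasDerivAt (fun s => Real.log (g s)) (deriv g t / g t) t :=
    fun t ht => (hder t ht).log (hpos t (Ioo_subset_Icc_self ht)).ne'
  have hnonneg : ∀ t ∈ Ioo a b, 0 ≤ |deriv g t| / g t := fun t ht =>
    div_nonneg (abs_nonneg _) (hpos t (Ioo_subset_Icc_self ht)).le
  have hlogbd : ∀ t ∈ Icc a b, Real.log m ≤ Real.log (g t) ∧ Real.log (g t) ≤ Real.log M :=
    fun t ht => ⟨Real.log_le_log hm (hbd t ht).1, Real.log_le_log (hpos t ht) (hbd t ht).2⟩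
  have ha := hlogbd a (left_mem_Icc.2 hab)
  have hb := hlogbd b (right_mem_Icc.2 hab)
  have key : ∀ h : ℝ → ℝ, ContinuousOn h (Icc a b) →
      (∀ t ∈ Ioo a b, HasDerivAt h (|deriv g t| / g t) t) →
      h b - h a ≤ Real.log M - Real.log m →
      IntervalIntegrable (fun t => |deriv g t| / g t) MeasureTheory.volume a b ∧
        ∫ t in a..b, |deriv g t| / g t ≤ Real.log M - Real.log m := by
    intro h hc hh hle
    have hint : IntervalIntegrable (fun t => |deriv g t| / g t) MeasureTheory.volume a b :=
      (intervalIntegrable_iff_integrableOn_Ioc_of_le hab).2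
        (intervalIntegral.integrableOn_deriv_of_nonneg hc hh hnonneg)
    exact ⟨hint, (intervalIntegral.integral_eq_sub_of_hasDerivAt_of_le hab hc hh hint).trans_le hle⟩
  rcases hasDerivWithinAt_forall_lt_or_forall_gt_of_forall_ne (convex_Ioo a b)
    (fun t ht => (hder t ht).hasDerivWithinAt) hd with hneg | hgt
  · refine key (fun t => -Real.log (g t)) hlog.neg (fun t ht => ?_) (by linarith)
    rw [abs_of_neg (hneg t ht), neg_div]
    exact (hderlog t ht).neg
  · refine key (fun t => Real.log (g t)) hlog (fun t ht => ?_) (by linarith)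
    rw [abs_of_pos (hgt t ht)]
    exact hderlog t ht

/-- If `f : [0,T] × Ξ → ℝ` (with `Ξ = {|ξ| ≥ R}`) is uniformly Lipschitz in `t`, bounded
above and below by `C₂(1+|ξ|)^A` and `C₁(1+|ξ|)^{-A}`, and for each `ξ` is piecewise `C¹`
with nonvanishing derivative on at most `ν` subintervals of a partition of `[0,T]`, then
`∫₀ᵀ |∂_t f|/f dt ≤ C log(1+|ξ|)` with `C` depending only on `A, C₀, C₁, C₂, ν, T, R`. -/
theorem stmt_7 (A C₀ C₁ C₂ T R : ℝ) (ν : ℕ)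
    (hA : 0 < A) (hC₀ : 0 < C₀) (hC₁ : 0 < C₁) (hC₂ : 0 < C₂) (hT : 0 < T) (hR : 0 < R) :
    ∃ C > (0 : ℝ), ∀ n : ℕ, 1 ≤ n → ∀ f : ℝ → EuclideanSpace ℝ (Fin n) → ℝ,
      (∀ ξ : EuclideanSpace ℝ (Fin n), R ≤ ‖ξ‖ →
        ∀ t₁ ∈ Icc (0 : ℝ) T, ∀ t₂ ∈ Icc (0 : ℝ) T,
          |f t₁ ξ - f t₂ ξ| ≤ C₀ * |t₁ - t₂|) →
      (∀ t ∈ Icc (0 : ℝ) T, ∀ ξ : EuclideanSpace ℝ (Fin n), R ≤ ‖ξ‖ →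
        C₁ * (1 + ‖ξ‖) ^ (-A) ≤ f t ξ ∧ f t ξ ≤ C₂ * (1 + ‖ξ‖) ^ A) →
      (∀ ξ : EuclideanSpace ℝ (Fin n), R ≤ ‖ξ‖ →
        ∃ μ : ℕ, 2 ≤ μ ∧ μ ≤ ν ∧ ∃ pt : ℕ → ℝ,
          pt 1 = 0 ∧ pt μ = T ∧
          (∀ j, 1 ≤ j → j < μ → pt j < pt (j + 1)) ∧
          (∀ j, 1 ≤ j → j < μ →
            ContDiffOn ℝ 1 (fun s => f s ξ) (Ioo (pt j) (pt (j + 1))) ∧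
            ∀ t ∈ Ioo (pt j) (pt (j + 1)), deriv (fun s => f s ξ) t ≠ 0)) →
      ∀ ξ : EuclideanSpace ℝ (Fin n), R ≤ ‖ξ‖ →
        ∫ t in (0 : ℝ)..T, |deriv (fun s => f s ξ) t| / f t ξ
          ≤ C * Real.log (1 + ‖ξ‖) := by
  have hL : 0 < Real.log (1 + R) := Real.log_pos (by linarith)
  set D := |Real.log C₂ - Real.log C₁|
  refine ⟨ν * (D / Real.log (1 + R) + 2 * A) + 1, by positivity, ?_⟩
  intro n _ f hLip hbd hpart ξ hξ
  obtain ⟨μ, hμ2, hμν, pt, h0, h1, hlt, hpt⟩ := hpart ξ hξ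
  have hX : 0 < 1 + ‖ξ‖ := by positivity
  have hLξ : Real.log (1 + R) ≤ Real.log (1 + ‖ξ‖) := Real.log_le_log (by linarith) (by linarith)
  have hcont : ContinuousOn (fun s => f s ξ) (Icc 0 T) :=
    (LipschitzOnWith.of_dist_le_mul (K := ⟨C₀, hC₀.le⟩) fun x hx y hy =>
      hLip ξ hξ x hx y hy).continuousOn
  have hmono : MonotoneOn pt (Icc 1 μ) := by
    intro i hi j hj hij
    induction j, hij using Nat.le_induction with
    | base => exact le_rfl
    | succ k hk ih =>
      have hk1 : 1 ≤ k := hi.1.trans hk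
      have hkμ : k < μ := hj.2
      exact (ih ⟨hk1, hkμ.le⟩).trans (hlt k hk1 hkμ).le
  have hpiece : ∀ j ∈ Ico 1 μ,
      IntervalIntegrable (fun t => |deriv (fun s => f s ξ) t| / f t ξ) MeasureTheory.volume
        (pt j) (pt (j + 1)) ∧
      ∫ t in (pt j)..(pt (j + 1)), |deriv (fun s => f s ξ) t| / f t ξ ≤
        Real.log (C₂ * (1 + ‖ξ‖) ^ A) - Real.log (C₁ * (1 + ‖ξ‖) ^ (-A)) := by
    rintro j ⟨hj1, hjμ⟩
    have hsub : Icc (pt j) (pt (j + 1)) ⊆ Icc 0 T := by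
      refine Icc_subset_Icc ?_ ?_
      · exact h0 ▸ hmono ⟨le_rfl, by omega⟩ ⟨hj1, hjμ.le⟩ hj1
      · exact h1 ▸ hmono ⟨by omega, hjμ⟩ ⟨by omega, le_rfl⟩ hjμ
    exact integral_abs_deriv_div_le_log_sub_log (hlt j hj1 hjμ).le (by positivity)
      (hcont.mono hsub) (fun t ht => hbd t (hsub ht) ξ hξ) (hpt j hj1 hjμ).2
  have hvar : Real.log (C₂ * (1 + ‖ξ‖) ^ A) - Real.log (C₁ * (1 + ‖ξ‖) ^ (-A)) ≤
      (D / Real.log (1 + R) + 2 * A) * Real.log (1 + ‖ξ‖) := by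
    rw [Real.log_mul hC₂.ne' (by positivity), Real.log_mul hC₁.ne' (by positivity),
      Real.log_rpow hX, Real.log_rpow hX]
    have h2 : D ≤ D / Real.log (1 + R) * Real.log (1 + ‖ξ‖) := by
      rw [div_mul_eq_mul_div, le_div_iff₀ hL]
      exact mul_le_mul_of_nonneg_left hLξ (abs_nonneg _)
    have h3 : Real.log C₂ - Real.log C₁ ≤ D := le_abs_self _
    linarith
  have hK : 0 ≤ (D / Real.log (1 + R) + 2 * A) * Real.log (1 + ‖ξ‖) :=
    mul_nonneg (by positivity) (hL.le.trans hLξ)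
  calc ∫ t in (0 : ℝ)..T, |deriv (fun s => f s ξ) t| / f t ξ
      = ∑ j ∈ Finset.Ico 1 μ,
          ∫ t in (pt j)..(pt (j + 1)), |deriv (fun s => f s ξ) t| / f t ξ := by
        rw [intervalIntegral.sum_integral_adjacent_intervals_Ico (by omega)
          fun j hj => (hpiece j hj).1, h0, h1]
    _ ≤ ∑ _j ∈ Finset.Ico 1 μ, (D / Real.log (1 + R) + 2 * A) * Real.log (1 + ‖ξ‖) :=
        Finset.sum_le_sum fun j hj => (hpiece j (by simpa using hj)).2.trans hvar
    _ = ((μ - 1 : ℕ) : ℝ) * ((D / Real.log (1 + R) + 2 * A) * Real.log (1 + ‖ξ‖)) := by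
        simp
    _ ≤ ν * ((D / Real.log (1 + R) + 2 * A) * Real.log (1 + ‖ξ‖)) :=
        mul_le_mul_of_nonneg_right (by exact_mod_cast (Nat.sub_le _ _).trans hμν) hK
    _ ≤ (ν * (D / Real.log (1 + R) + 2 * A) + 1) * Real.log (1 + ‖ξ‖) := by
        linarith
end

section
/- Let I⊆ℝ be an open interval, let τ1,τ2,τ3:I→ℝ be twice continuously differentiable, and let v:I→ℂ be three times continuously differentiable. Define L_j w = w' − i·τ_j·w for j=1,2,3 and L_{123}v = v''' − i(τ1+τ2+τ3)v'' − (τ1τ2+τ2τ3+τ3τ1)v' + i·τ1τ2τ3·v. Then for every t∈I: (1/6)·Σ_{(a,b,c)} L_a(L_b(L_c v))(t), where the sum ranges over all six permutations (a,b,c) of (1,2,3), equals L_{123}v(t) − (i/2)·[τ1'(t)(L_2v(t)+L_3v(t)) + τ2'(t)(L_3v(t)+L_1v(t)) + τ3'(t)(L_1v(t)+L_2v(t))] − (i/3)·(τ1''(t)+τ2''(t)+τ3''(t))·v(t). -/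
open Complex

/-- The first-order operator `L_τ w = w' - i τ w`. -/
noncomputable def Lop (τ : ℝ → ℝ) (w : ℝ → ℂ) : ℝ → ℂ :=
  fun s => deriv w s - Complex.I * (τ s : ℂ) * w s

/-- The third-order operator with symbol `(τ - iτ1)(τ - iτ2)(τ - iτ3)` in `∂_t`:
`L_{123} v = v''' - i(τ1+τ2+τ3)v'' - (τ1τ2+τ2τ3+τ3τ1)v' + i τ1τ2τ3 v`. -/
noncomputable def L123 (τ1 τ2 τ3 : ℝ → ℝ) (v : ℝ → ℂ) : ℝ → ℂ :=
  fun s => deriv (deriv (deriv v)) s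
    - Complex.I * ((τ1 s : ℂ) + (τ2 s : ℂ) + (τ3 s : ℂ)) * deriv (deriv v) s
    - ((τ1 s : ℂ) * (τ2 s : ℂ) + (τ2 s : ℂ) * (τ3 s : ℂ) + (τ3 s : ℂ) * (τ1 s : ℂ))
      * deriv v s
    + Complex.I * (τ1 s : ℂ) * (τ2 s : ℂ) * (τ3 s : ℂ) * v s

/-- Expansion of the composition of two first-order operators at a point. -/
theorem Lop_Lop_apply {α β : ℝ → ℝ} {v : ℝ → ℂ} {s : ℝ} (hβ : DifferentiableAt ℝ β s)
    (hv : DifferentiableAt ℝ v s) (hv' : DifferentiableAt ℝ (deriv v) s) :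
    Lop α (Lop β v) s = deriv (deriv v) s
      - Complex.I * ((α s : ℂ) + (β s : ℂ)) * deriv v s
      - (Complex.I * ((deriv β s : ℝ) : ℂ) + (α s : ℂ) * (β s : ℂ)) * v s := by
  have h : HasDerivAt (Lop β v) _ s :=
    hv'.hasDerivAt.sub ((hβ.hasDerivAt.ofReal_comp.const_mul Complex.I).mul hv.hasDerivAt)
  simp only [Lop] at h ⊢
  rw [h.deriv]
  linear_combination (α s : ℂ) * (β s : ℂ) * v s * Complex.I_sq

/-- Expansion of the composition of three first-order operators at a point of an open set. -/
theorem Lop_Lop_Lop_apply {α β γ : ℝ → ℝ} {v : ℝ → ℂ} {U : Set ℝ} (hU : IsOpen U)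
    (hβ : ContDiffOn ℝ 1 β U) (hγ : ContDiffOn ℝ 2 γ U) (hv : ContDiffOn ℝ 3 v U)
    {t : ℝ} (ht : t ∈ U) :
    Lop α (Lop β (Lop γ v)) t = L123 α β γ v t
      - Complex.I * (((deriv β t : ℝ) : ℂ) + 2 * ((deriv γ t : ℝ) : ℂ)) * deriv v t
      - (Complex.I * ((deriv (deriv γ) t : ℝ) : ℂ) + ((deriv β t : ℝ) : ℂ) * (γ t : ℂ)
          + (β t : ℂ) * ((deriv γ t : ℝ) : ℂ) + (α t : ℂ) * ((deriv γ t : ℝ) : ℂ)) * v t := by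
  have hγ' : ContDiffOn ℝ 1 (deriv γ) U := hγ.deriv_of_isOpen hU (by norm_num)
  have hv' : ContDiffOn ℝ 2 (deriv v) U := hv.deriv_of_isOpen hU (by norm_num)
  have hv'' : ContDiffOn ℝ 1 (deriv (deriv v)) U := hv'.deriv_of_isOpen hU (by norm_num)
  have dβ := (hβ.differentiableOn (by norm_num)).differentiableAt (hU.mem_nhds ht)
  have dγ {s} (hs : s ∈ U) := (hγ.differentiableOn (by norm_num)).differentiableAt (hU.mem_nhds hs)
  have dγ' := (hγ'.differentiableOn (by norm_num)).differentiableAt (hU.mem_nhds ht)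
  have dv {s} (hs : s ∈ U) := (hv.differentiableOn (by norm_num)).differentiableAt (hU.mem_nhds hs)
  have dv' {s} (hs : s ∈ U) :=
    (hv'.differentiableOn (by norm_num)).differentiableAt (hU.mem_nhds hs)
  have dv'' := (hv''.differentiableOn (by norm_num)).differentiableAt (hU.mem_nhds ht)
  have heq : Lop β (Lop γ v) =ᶠ[nhds t] fun s => deriv (deriv v) s
      - Complex.I * ((β s : ℂ) + (γ s : ℂ)) * deriv v s
      - (Complex.I * ((deriv γ s : ℝ) : ℂ) + (β s : ℂ) * (γ s : ℂ)) * v s := by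
    filter_upwards [hU.mem_nhds ht] with s hs
    exact Lop_Lop_apply (dγ hs) (dv hs) (dv' hs)
  have cβ := dβ.hasDerivAt.ofReal_comp
  have cγ := (dγ ht).hasDerivAt.ofReal_comp
  have hd := (dv''.hasDerivAt.sub (((cβ.add cγ).const_mul Complex.I).mul (dv' ht).hasDerivAt)).sub
    (((dγ'.hasDerivAt.ofReal_comp.const_mul Complex.I).add (cβ.mul cγ)).mul (dv ht).hasDerivAt)
  have hd' := (hd.congr_of_eventuallyEq heq).deriv
  rw [Lop, hd', heq.eq_of_nhds, L123]
  simp only [Pi.add_apply, Pi.mul_apply]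
  linear_combination ((α t : ℂ) * ((β t : ℂ) + (γ t : ℂ)) * deriv v t
    + (α t : ℂ) * ((deriv γ t : ℝ) : ℂ) * v t) * Complex.I_sq

/-- The fully symmetrized third-order composition equals
`L_{123}v - (i/2)[τ1'(L_2v+L_3v) + τ2'(L_3v+L_1v) + τ3'(L_1v+L_2v)]
 - (i/3)(τ1''+τ2''+τ3'')v` on an open interval. -/
theorem stmt_18 (a b : ℝ) (τ1 τ2 τ3 : ℝ → ℝ) (v : ℝ → ℂ)
    (hτ1 : ContDiffOn ℝ 2 τ1 (Set.Ioo a b)) (hτ2 : ContDiffOn ℝ 2 τ2 (Set.Ioo a b))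
    (hτ3 : ContDiffOn ℝ 2 τ3 (Set.Ioo a b)) (hv : ContDiffOn ℝ 3 v (Set.Ioo a b))
    (t : ℝ) (ht : t ∈ Set.Ioo a b) :
    (1 / 6 : ℂ) * (Lop τ1 (Lop τ2 (Lop τ3 v)) t + Lop τ1 (Lop τ3 (Lop τ2 v)) t
        + Lop τ2 (Lop τ1 (Lop τ3 v)) t + Lop τ2 (Lop τ3 (Lop τ1 v)) t
        + Lop τ3 (Lop τ1 (Lop τ2 v)) t + Lop τ3 (Lop τ2 (Lop τ1 v)) t)
      = L123 τ1 τ2 τ3 v t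
        - Complex.I / 2 *
          (((deriv τ1 t : ℝ) : ℂ) * (Lop τ2 v t + Lop τ3 v t)
            + ((deriv τ2 t : ℝ) : ℂ) * (Lop τ3 v t + Lop τ1 v t)
            + ((deriv τ3 t : ℝ) : ℂ) * (Lop τ1 v t + Lop τ2 v t))
        - Complex.I / 3 *
          (((deriv (deriv τ1) t : ℝ) : ℂ) + ((deriv (deriv τ2) t : ℝ) : ℂ)
            + ((deriv (deriv τ3) t : ℝ) : ℂ)) * v t := by
  have h1 := hτ1.of_le (one_le_two)
  have h2 := hτ2.of_le (one_le_two)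
  have h3 := hτ3.of_le (one_le_two)
  rw [Lop_Lop_Lop_apply isOpen_Ioo h2 hτ3 hv ht, Lop_Lop_Lop_apply isOpen_Ioo h3 hτ2 hv ht,
    Lop_Lop_Lop_apply isOpen_Ioo h1 hτ3 hv ht, Lop_Lop_Lop_apply isOpen_Ioo h3 hτ1 hv ht,
    Lop_Lop_Lop_apply isOpen_Ioo h1 hτ2 hv ht, Lop_Lop_Lop_apply isOpen_Ioo h2 hτ1 hv ht]
  simp only [L123, Lop]
  linear_combination (-1 / 2 : ℂ) * v t * (((deriv τ1 t : ℝ) : ℂ) * ((τ2 t : ℂ) + (τ3 t : ℂ))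
    + ((deriv τ2 t : ℝ) : ℂ) * ((τ3 t : ℂ) + (τ1 t : ℂ))
    + ((deriv τ3 t : ℝ) : ℂ) * ((τ1 t : ℂ) + (τ2 t : ℂ))) * Complex.I_sq
end

section
/- Let I⊆ℝ be an open interval, let τ1,τ2,τ3:I→ℝ and s:I→ℝ be differentiable at a point t₀∈I, and suppose that s(t)² = (2/9)·[(τ1(t)−τ2(t))²+(τ2(t)−τ3(t))²+(τ3(t)−τ1(t))²] for all t∈I, that s(t₀)≠0, and that τ_j(t₀)≠τ_k(t₀) for all (j,k)∈S2. Then |s'(t₀)/s(t₀)| ≤ Σ_{(j,k)∈S2} |τ_j'(t₀)−τ_k'(t₀)| / |τ_j(t₀)−τ_k(t₀)|. -/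
theorem abs_mul_le_mul_abs_div_abs {x e Q : ℝ} (hx : x ≠ 0) (hQ : x ^ 2 ≤ Q) :
    |x * e| ≤ Q * (|e| / |x|) := by
  have hx' : 0 < |x| := abs_pos.mpr hx
  calc |x * e| = x ^ 2 * (|e| / |x|) := by rw [abs_mul, ← sq_abs x]; field_simp
    _ ≤ Q * (|e| / |x|) := by gcongr

/-- If `s² = (2/9)[(τ1-τ2)² + (τ2-τ3)² + (τ3-τ1)²]` on an open interval, all functions are
differentiable at `t₀`, `s(t₀) ≠ 0` and the `τ_j(t₀)` are pairwise distinct (over the cyclic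
pairs `S2 = {(1,2),(2,3),(3,1)}`), then
`|s'(t₀)/s(t₀)| ≤ Σ_{(j,k)∈S2} |τ_j'(t₀)-τ_k'(t₀)|/|τ_j(t₀)-τ_k(t₀)|`. -/
theorem stmt_19 (a b t₀ : ℝ) (ht₀ : t₀ ∈ Set.Ioo a b)
    (τ1 τ2 τ3 s : ℝ → ℝ) (d1 d2 d3 ds : ℝ)
    (hτ1 : HasDerivAt τ1 d1 t₀) (hτ2 : HasDerivAt τ2 d2 t₀) (hτ3 : HasDerivAt τ3 d3 t₀)
    (hs : HasDerivAt s ds t₀)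
    (hsq : ∀ t ∈ Set.Ioo a b,
      (s t) ^ 2 = (2 / 9) * ((τ1 t - τ2 t) ^ 2 + (τ2 t - τ3 t) ^ 2 + (τ3 t - τ1 t) ^ 2))
    (hs0 : s t₀ ≠ 0)
    (h12 : τ1 t₀ ≠ τ2 t₀) (h23 : τ2 t₀ ≠ τ3 t₀) (h31 : τ3 t₀ ≠ τ1 t₀) :
    |ds / s t₀|
      ≤ |d1 - d2| / |τ1 t₀ - τ2 t₀| + |d2 - d3| / |τ2 t₀ - τ3 t₀|
        + |d3 - d1| / |τ3 t₀ - τ1 t₀| := by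
  have hderiv := (((hτ1.sub hτ2).pow 2).add ((hτ2.sub hτ3).pow 2)).add ((hτ3.sub hτ1).pow 2)
  have heq := ((hs.pow 2).congr_of_eventuallyEq
    ((Filter.eventually_of_mem (Ioo_mem_nhds ht₀.1 ht₀.2) fun t ht => (hsq t ht).symm) :
      _ =ᶠ[nhds t₀] _)).unique (hderiv.const_mul (2 / 9))
  have hsq₀ := hsq t₀ ht₀
  simp only [Pi.sub_apply, Nat.cast_ofNat, Nat.add_one_sub_one, pow_one] at heq
  set x := τ1 t₀ - τ2 t₀
  set y := τ2 t₀ - τ3 t₀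
  set z := τ3 t₀ - τ1 t₀
  have hsd : ds * s t₀ = 2 / 9 * (x * (d1 - d2) + y * (d2 - d3) + z * (d3 - d1)) := by
    linarith
  have hx := abs_mul_le_mul_abs_div_abs (x := x) (e := d1 - d2) (Q := x ^ 2 + y ^ 2 + z ^ 2)
    (sub_ne_zero.mpr h12) (by nlinarith [sq_nonneg y, sq_nonneg z])
  have hy := abs_mul_le_mul_abs_div_abs (x := y) (e := d2 - d3) (Q := x ^ 2 + y ^ 2 + z ^ 2)
    (sub_ne_zero.mpr h23) (by nlinarith [sq_nonneg x, sq_nonneg z])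
  have hz := abs_mul_le_mul_abs_div_abs (x := z) (e := d3 - d1) (Q := x ^ 2 + y ^ 2 + z ^ 2)
    (sub_ne_zero.mpr h31) (by nlinarith [sq_nonneg x, sq_nonneg y])
  have hpos : 0 < s t₀ ^ 2 := by positivity
  have hdiv : ds / s t₀ = ds * s t₀ / s t₀ ^ 2 := by field_simp
  rw [hdiv, abs_div, abs_of_pos hpos, div_le_iff₀ hpos, hsd, hsq₀, abs_mul,
    abs_of_pos (by norm_num : (0 : ℝ) < 2 / 9)]
  linarith [abs_add_three (x * (d1 - d2)) (y * (d2 - d3)) (z * (d3 - d1))]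
end
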